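/- A finite simple graph G has a {P₃, P₄, P₅}-factor (a spanning subgraph each of whose components is a path on 3, 4, or 5 vertices) if and only if for every subset S ⊆ V(G), the number of components of G − S that are suns is at most 2|S|. -/

import Mathlib

/-- `H` is (isomorphic to) a path on `n` vertices. -/
def IsPathOn {W : Type*} (H : SimpleGraph W) (n : ℕ) : Prop :=
  Nonempty (H ≃g SimpleGraph.pathGraph n)

/-- A graph is factor-critical if deleting any vertex leaves a graph with a perfect
matching. -/
def IsFactorCritical {W : Type*} (R : SimpleGraph W) : Prop :=
  ∀ x : W, ∃ M : (R.induce {y : W | y ≠ x}).Subgraph, M.IsPerfectMatching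

/-- `H` is a sun: `H = K₁`, `H = K₂`, or `H` is obtained from a factor-critical graph `R`
(its core, here an induced subgraph on a vertex set `R`) by attaching to each core vertex
`v` a pendant vertex `p v` whose unique neighbor is `v`. -/
def IsSun {W : Type*} (H : SimpleGraph W) : Prop :=
  Nat.card W = 1 ∨
  (Nat.card W = 2 ∧ ∀ u v : W, u ≠ v → H.Adj u v) ∨
  ∃ (R : Set W) (p : R ≃ (Rᶜ : Set W)),
    IsFactorCritical (H.induce R) ∧
    (∀ v : R, H.Adj (↑v) (↑(p v))) ∧
    (∀ u : (Rᶜ : Set W), ∀ x : W, H.Adj (↑u) x ↔ x = ↑(p.symm u))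

/-- The number of connected components of `G − S` that are suns. -/
noncomputable def sunCount {V : Type*} [Fintype V] (G : SimpleGraph V) (S : Set V) : ℕ :=
  Nat.card {c : (G.induce Sᶜ).ConnectedComponent //
    IsSun ((G.induce Sᶜ).induce c.supp)}

/-- `H` has a `{P₃, P₄, P₅}`-factor: a spanning subgraph each of whose components is a
path on 3, 4, or 5 vertices. -/
def HasPPPFactor {W : Type*} (H : SimpleGraph W) : Prop :=
  ∃ F : SimpleGraph W, F ≤ H ∧ ∀ c : F.ConnectedComponent,
    IsPathOn (F.induce c.supp) 3 ∨ IsPathOn (F.induce c.supp) 4 ∨ IsPathOn (F.induce c.supp) 5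

namespace Kaneko

open Finset

set_option linter.unusedSectionVars false

variable {V : Type*} [DecidableEq V]

/-- `B` is closed under taking `H`-neighbours inside `X`. -/
def Closed (H : SimpleGraph V) (X B : Finset V) : Prop :=
  ∀ x ∈ B, ∀ y ∈ X, H.Adj x y → y ∈ B

/-- `C` is the vertex set of a connected component of `H[X]`, i.e. a minimal nonempty closed
subset of `X`. -/
structure Comp (H : SimpleGraph V) (X C : Finset V) : Prop where
  sub : C ⊆ X
  ne : C.Nonempty
  closed : Closed H X C
  min : ∀ B ⊆ C, B.Nonempty → Closed H C B → B = C

/-- `H[A]` has a perfect matching, given as a fixed-point-free involution. -/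
def PM (H : SimpleGraph V) (A : Finset V) : Prop :=
  ∃ m : V → V, ∀ x ∈ A, m x ∈ A ∧ H.Adj x (m x) ∧ m (m x) = x

/-- `H[R]` is factor-critical and nonempty. -/
def FC (H : SimpleGraph V) (R : Finset V) : Prop :=
  R.Nonempty ∧ ∀ x ∈ R, PM H (R.erase x)

/-- `H[C]` consists of the factor-critical core `H[R]` together with a pendant vertex `p r` at
every `r ∈ R`. -/
structure Corona (H : SimpleGraph V) (C R : Finset V) (p : V → V) : Prop where
  fc : FC H R
  eq : C = R ∪ R.image p
  inj : Set.InjOn p R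
  notMem : ∀ r ∈ R, p r ∉ R
  adj : ∀ r ∈ R, H.Adj r (p r)
  uniq : ∀ r ∈ R, ∀ y ∈ C, H.Adj (p r) y → y = r

/-- `H[C]` is a sun. The sun `K₂` is a corona with a one-vertex core. -/
def Sun (H : SimpleGraph V) (C : Finset V) : Prop :=
  (∃ x, C = {x}) ∨ ∃ R p, Corona H C R p

open Classical in
/-- The sun components of `H[X]`. -/
noncomputable def suns (H : SimpleGraph V) (X : Finset V) : Finset (Finset V) :=
  X.powerset.filter fun C => Comp H X C ∧ Sun H C

/-- Kaneko's condition for `H[A]`. -/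
def Kan (H : SimpleGraph V) (A : Finset V) : Prop :=
  ∀ S ⊆ A, (suns H (A \ S)).card ≤ 2 * S.card

/-- `A` can be partitioned into vertex sets of paths of `H` on three to five vertices. -/
inductive Tiled (H : SimpleGraph V) : Finset V → Prop
  | empty : Tiled H ∅
  | cons {A : Finset V} (l : List V) : l.Nodup → l.IsChain H.Adj → 3 ≤ l.length →
      l.length ≤ 5 → Disjoint l.toFinset A → Tiled H A → Tiled H (l.toFinset ∪ A)

variable {H H' : SimpleGraph V} {X Y A B C D R S T U : Finset V} {p : V → V}

/-! ### Tilings -/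

theorem Tiled.mono (hH : H ≤ H') (h : Tiled H A) : Tiled H' A := by
  induction h with
  | empty => exact .empty
  | cons l h1 h2 h3 h4 h5 _ ih => exact .cons l h1 (h2.imp fun _ _ h => hH h) h3 h4 h5 ih

theorem Tiled.union (hA : Tiled H A) (hB : Tiled H B) (hd : Disjoint A B) :
    Tiled H (A ∪ B) := by
  induction hA with
  | empty => simpa using hB
  | @cons A l h1 h2 h3 h4 h5 _ ih =>
    rw [disjoint_union_left] at hd
    rw [union_assoc]
    exact .cons l h1 h2 h3 h4 (disjoint_union_right.2 ⟨h5, hd.1⟩) (ih hd.2)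

theorem Tiled.biUnion {ι : Type*} [DecidableEq ι] (I : Finset ι) (f : ι → Finset V)
    (h : ∀ i ∈ I, Tiled H (f i)) (hd : ∀ i ∈ I, ∀ j ∈ I, i ≠ j → Disjoint (f i) (f j)) :
    Tiled H (I.biUnion f) := by
  induction I using Finset.induction_on with
  | empty => exact .empty
  | insert i I hi ih =>
    rw [biUnion_insert]
    refine (h i (mem_insert_self _ _)).union
      (ih (fun j hj => h j (mem_insert_of_mem hj))
        fun j hj k hk => hd j (mem_insert_of_mem hj) k (mem_insert_of_mem hk)) ?_
    rw [disjoint_biUnion_right]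
    intro j hj
    exact hd i (mem_insert_self _ _) j (mem_insert_of_mem hj) (by rintro rfl; exact hi hj)

theorem Tiled.path (l : List V) (h1 : l.Nodup) (h2 : l.IsChain H.Adj) (h3 : 3 ≤ l.length)
    (h4 : l.length ≤ 5) : Tiled H l.toFinset := by
  simpa using Tiled.cons l h1 h2 h3 h4 (disjoint_empty_right _) .empty

theorem tiled_three {a b c : V} (hab : H.Adj a b) (hbc : H.Adj b c) (hac : a ≠ c) :
    Tiled H {a, b, c} := by
  have := Tiled.path (H := H) [a, b, c] (by simp [hab.ne, hbc.ne, hac]) (by simp [hab, hbc])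
    (by simp) (by simp)
  simpa using this

theorem tiled_four {a b c d : V} (hab : H.Adj a b) (hbc : H.Adj b c) (hcd : H.Adj c d)
    (hac : a ≠ c) (had : a ≠ d) (hbd : b ≠ d) : Tiled H {a, b, c, d} := by
  have := Tiled.path (H := H) [a, b, c, d] (by simp [hab.ne, hbc.ne, hac, hcd.ne, had, hbd])
    (by simp [hab, hbc, hcd]) (by simp) (by simp)
  simpa using this

theorem tiled_five {a b c d e : V} (hab : H.Adj a b) (hbc : H.Adj b c) (hcd : H.Adj c d)
    (hde : H.Adj d e) (hac : a ≠ c) (had : a ≠ d) (hae : a ≠ e) (hbd : b ≠ d) (hbe : b ≠ e)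
    (hce : c ≠ e) : Tiled H {a, b, c, d, e} := by
  have := Tiled.path (H := H) [a, b, c, d, e]
    (by simp [hab.ne, hbc.ne, hac, hcd.ne, had, hbd, hde.ne, hae, hbe, hce])
    (by simp [hab, hbc, hcd, hde]) (by simp) (by simp)
  simpa using this

/-! ### Closed sets and components -/

theorem Closed.sdiff (h : Closed H X B) : Closed H X (X \ B) := by
  intro x hx y hy hxy
  rw [mem_sdiff] at hx ⊢
  exact ⟨hy, fun hyB => hx.2 (h y hyB x hx.1 hxy.symm)⟩

theorem Closed.anti (h : Closed H X B) (hY : Y ⊆ X) : Closed H Y B :=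
  fun x hx y hy => h x hx y (hY hy)

theorem Comp.eq_of_mem {x : V} (h : Comp H X C) (h' : Comp H X D) (hx : x ∈ C) (hx' : x ∈ D) :
    C = D := by
  have key : ∀ {C D : Finset V}, Comp H X C → Comp H X D → x ∈ C → x ∈ D → C ⊆ D := by
    intro C D h h' hx hx'
    have := h.min (C ∩ D) inter_subset_left ⟨x, mem_inter.2 ⟨hx, hx'⟩⟩
      (fun a ha b hb hab => mem_inter.2 ⟨hb, h'.closed a (mem_inter.1 ha).2 b (h.sub hb) hab⟩)
    rw [← this]; exact inter_subset_right
  exact (key h h' hx hx').antisymm (key h' h hx' hx)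

theorem Comp.disjoint (h : Comp H X C) (h' : Comp H X D) (hne : C ≠ D) : Disjoint C D := by
  rw [disjoint_left]
  exact fun x hx hx' => hne (h.eq_of_mem h' hx hx')

theorem Comp.anti (h : Comp H X C) (hY : Y ⊆ X) (hC : C ⊆ Y) : Comp H Y C :=
  ⟨hC, h.ne, h.closed.anti hY, h.min⟩

/-- A component of a set stays a component in a larger set if it is still closed there. -/
theorem Comp.of_closed (h : Comp H Y C) (hC : C ⊆ X) (hcl : Closed H X C) : Comp H X C :=
  ⟨hC, h.ne, hcl, h.min⟩

theorem exists_comp {x : V} (hx : x ∈ X) : ∃ C, Comp H X C ∧ x ∈ C := by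
  classical
  obtain ⟨C, hC, hmin⟩ := exists_min_image
    (X.powerset.filter fun B => Closed H X B ∧ x ∈ B) card
    ⟨X, by simp [hx]; intro a _ b hb _; exact hb⟩
  simp only [mem_filter, mem_powerset] at hC hmin
  obtain ⟨hCX, hcl, hxC⟩ := hC
  refine ⟨C, ⟨hCX, ⟨x, hxC⟩, hcl, fun B hBC hBne hB => ?_⟩, hxC⟩
  have hBX : Closed H X B := fun a ha b hb hab => hB a ha b (hcl a (hBC ha) b hb hab) hab
  by_cases hxB : x ∈ B
  · exact eq_of_subset_of_card_le hBC (hmin B ⟨hBC.trans hCX, hBX, hxB⟩)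
  · exfalso
    have h1 : Closed H X (C \ B) := by
      intro a ha b hb hab
      rw [mem_sdiff] at ha ⊢
      exact ⟨hcl a ha.1 b hb hab, fun h => ha.2 (hBX b h a (hCX ha.1) hab.symm)⟩
    have h2 := hmin (C \ B) ⟨sdiff_subset.trans hCX, h1, mem_sdiff.2 ⟨hxC, hxB⟩⟩
    have h3 : (C \ B).card < C.card := by
      refine card_lt_card ⟨sdiff_subset, fun h => ?_⟩
      obtain ⟨b, hb⟩ := hBne
      exact (mem_sdiff.1 (h (hBC hb))).2 hb
    omega

/-- Transfer of a component between graphs that agree on it. -/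
theorem Comp.congr (h : Comp H X C) (hC : C ⊆ Y) (hcl : Closed H' Y C)
    (hH : ∀ x ∈ C, ∀ y ∈ C, H.Adj x y ↔ H'.Adj x y) : Comp H' Y C :=
  ⟨hC, h.ne, hcl, fun B hB hne hB' => h.min B hB hne fun x hx y hy hxy =>
    hB' x hx y hy ((hH x (hB hx) y hy).1 hxy)⟩

theorem comp_singleton {x : V} (hx : x ∈ X) (h : ∀ y ∈ X, ¬ H.Adj x y) : Comp H X {x} := by
  refine ⟨by simpa using hx, by simp, fun a ha b hb hab => ?_, fun B hB hne _ => ?_⟩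
  · rw [mem_singleton] at ha; subst ha; exact absurd hab (h b hb)
  · exact (subset_singleton_iff.1 hB).resolve_left hne.ne_empty

theorem mem_suns : C ∈ suns H X ↔ Comp H X C ∧ Sun H C := by
  simp only [suns, mem_filter, mem_powerset, and_iff_right_iff_imp]
  exact fun h => h.1.sub

theorem sun_singleton (x : V) : Sun H {x} := .inl ⟨x, rfl⟩

/-! ### Matchings and suns -/

theorem PM.congr (h : PM H A) (hH : ∀ x ∈ A, ∀ y ∈ A, H.Adj x y → H'.Adj x y) : PM H' A := by
  obtain ⟨m, hm⟩ := h
  exact ⟨m, fun x hx => ⟨(hm x hx).1, hH _ hx _ (hm x hx).1 (hm x hx).2.1, (hm x hx).2.2⟩⟩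

theorem FC.congr (h : FC H A) (hH : ∀ x ∈ A, ∀ y ∈ A, H.Adj x y → H'.Adj x y) : FC H' A :=
  ⟨h.1, fun x hx => (h.2 x hx).congr fun a ha b hb =>
    hH a (mem_of_mem_erase ha) b (mem_of_mem_erase hb)⟩

theorem Sun.congr (h : Sun H C) (hH : ∀ x ∈ C, ∀ y ∈ C, H.Adj x y ↔ H'.Adj x y) : Sun H' C := by
  obtain h | ⟨R, p, h⟩ := h
  · exact .inl h
  · have hR : ∀ r ∈ R, r ∈ C := fun r hr => by rw [h.eq]; exact mem_union_left _ hr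
    have hP : ∀ r ∈ R, p r ∈ C := fun r hr => by
      rw [h.eq]; exact mem_union_right _ (mem_image_of_mem _ hr)
    exact .inr ⟨R, p, h.fc.congr fun x hx y hy => (hH x (hR x hx) y (hR y hy)).1, h.eq, h.inj,
      h.notMem, fun r hr => (hH _ (hR r hr) _ (hP r hr)).1 (h.adj r hr),
      fun r hr y hy hy' => h.uniq r hr y hy ((hH _ (hP r hr) _ hy).2 hy')⟩

theorem PM.even (h : PM H A) : Even A.card := by
  obtain ⟨m, hm⟩ := h
  have : ∑ x ∈ A, (1 : ZMod 2) = 0 :=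
    sum_involution (fun x _ => m x) (fun _ _ => by decide) (fun x hx _ => (hm x hx).2.1.ne')
      (fun x hx => (hm x hx).1) (fun x hx => (hm x hx).2.2)
  rw [sum_const, nsmul_eq_mul, mul_one] at this
  exact (ZMod.natCast_eq_zero_iff_even).1 this

theorem FC.odd (h : FC H R) : Odd R.card := by
  obtain ⟨x, hx⟩ := h.1
  have h1 := (h.2 x hx).even
  rw [← card_erase_add_one hx]
  exact h1.add_one

theorem PM.empty : PM H ∅ := ⟨id, by simp⟩

theorem PM.union (hA : PM H A) (hB : PM H B) (hd : Disjoint A B) : PM H (A ∪ B) := by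
  obtain ⟨m, hm⟩ := hA
  obtain ⟨n, hn⟩ := hB
  refine ⟨fun x => if x ∈ A then m x else n x, fun x hx => ?_⟩
  by_cases hxA : x ∈ A
  · simp [hxA, hm x hxA]
  · have hxB := (mem_union.1 hx).resolve_left hxA
    have := disjoint_right.1 hd (hn x hxB).1
    simp [hxA, hn x hxB, this]

theorem PM.pair {a b : V} (h : H.Adj a b) : PM H {a, b} := by
  refine ⟨fun x => if x = a then b else a, fun x hx => ?_⟩
  rcases mem_insert.1 hx with rfl | hx
  · simp [h, h.ne']
  · rw [mem_singleton] at hx; subst hx; simp [h.symm, h.ne']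

theorem PM.biUnion {ι : Type*} [DecidableEq ι] (I : Finset ι) (f : ι → Finset V)
    (h : ∀ i ∈ I, PM H (f i)) (hd : ∀ i ∈ I, ∀ j ∈ I, i ≠ j → Disjoint (f i) (f j)) :
    PM H (I.biUnion f) := by
  induction I using Finset.induction_on with
  | empty => exact .empty
  | insert i I hi ih =>
    rw [biUnion_insert]
    refine (h i (mem_insert_self _ _)).union
      (ih (fun j hj => h j (mem_insert_of_mem hj))
        fun j hj k hk => hd j (mem_insert_of_mem hj) k (mem_insert_of_mem hk)) ?_
    rw [disjoint_biUnion_right]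
    intro j hj
    exact hd i (mem_insert_self _ _) j (mem_insert_of_mem hj) (by rintro rfl; exact hi hj)

/-- Removing a matched pair from a matching. -/
theorem PM.exists_pair (h : PM H A) {x : V} (hx : x ∈ A) :
    ∃ y ∈ A, H.Adj x y ∧ PM H ((A.erase x).erase y) := by
  obtain ⟨m, hm⟩ := h
  refine ⟨m x, (hm x hx).1, (hm x hx).2.1, m, fun z hz => ?_⟩
  simp only [mem_erase] at hz ⊢
  obtain ⟨h1, h2, h3⟩ := hz
  refine ⟨⟨fun h => h2 ?_, fun h => h1 ?_, (hm z h3).1⟩, (hm z h3).2⟩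
  · rw [← (hm z h3).2.2, h, (hm x hx).2.2]
  · rw [← h, (hm z h3).2.2]

/-- In a factor-critical graph with more than one vertex, every vertex has a neighbour,
even after deleting another given vertex. -/
theorem FC.exists_adj (h : FC H R) {x y : V} (hx : x ∈ R) (hy : y ∈ R) (hxy : x ≠ y) :
    ∃ z ∈ R, z ≠ y ∧ H.Adj x z := by
  obtain ⟨z, hz, hxz, _⟩ := (h.2 y hy).exists_pair (mem_erase.2 ⟨hxy, hx⟩)
  exact ⟨z, mem_of_mem_erase hz, ne_of_mem_erase hz, hxz⟩

namespace Corona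

theorem core_mem (h : Corona H C R p) {r : V} (hr : r ∈ R) : r ∈ C := by
  rw [h.eq]; exact mem_union_left _ hr

theorem pendant_mem (h : Corona H C R p) {r : V} (hr : r ∈ R) : p r ∈ C := by
  rw [h.eq]; exact mem_union_right _ (mem_image_of_mem _ hr)

theorem cases (h : Corona H C R p) {v : V} (hv : v ∈ C) : v ∈ R ∨ ∃ r ∈ R, v = p r := by
  rw [h.eq, mem_union, mem_image] at hv
  exact hv.imp id fun ⟨r, hr, h⟩ => ⟨r, hr, h.symm⟩

/-- Matched sets of core vertices, with their pendants, are tiled by four-vertex paths. -/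
theorem tiled_of_PM (h : Corona H C R p) (hB : PM H B) (hBR : B ⊆ R) :
    Tiled H (B ∪ B.image p) := by
  induction hn : B.card using Nat.strong_induction_on generalizing B with
  | _ n ih =>
  rcases B.eq_empty_or_nonempty with rfl | ⟨x, hx⟩
  · simpa using Tiled.empty
  obtain ⟨y, hy, hxy, hB'⟩ := hB.exists_pair hx
  have hcard : ((B.erase x).erase y).card < n := by
    rw [← hn]
    exact (card_le_card (erase_subset _ _)).trans_lt (card_erase_lt_of_mem hx)
  have ht := ih _ hcard hB' ((erase_subset _ _).trans ((erase_subset _ _).trans hBR)) rfl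
  have hxR := hBR hx
  have hyR := hBR hy
  have h4 : Tiled H {p x, x, y, p y} := tiled_four (h.adj x hxR).symm hxy (h.adj y hyR)
    (fun e => h.notMem x hxR (e ▸ hyR)) (fun e => hxy.ne (h.inj hxR hyR e))
    (fun e => h.notMem y hyR (e ▸ hxR))
  convert h4.union ht ?_ using 1
  · ext v
    simp only [mem_union, mem_image, mem_insert, mem_singleton, mem_erase]
    constructor
    · rintro (hv | ⟨r, hr, rfl⟩)
      · by_cases hvx : v = x <;> by_cases hvy : v = y <;> simp_all
      · by_cases hrx : r = x <;> by_cases hry : r = y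
        · simp [hrx]
        · simp [hrx]
        · simp [hry]
        · exact .inr (.inr ⟨r, ⟨hry, hrx, hr⟩, rfl⟩)
    · rintro ((rfl | rfl | rfl | rfl) | hv | ⟨r, hr, rfl⟩)
      · exact .inr ⟨x, hx, rfl⟩
      · exact .inl hx
      · exact .inl hy
      · exact .inr ⟨y, hy, rfl⟩
      · exact .inl hv.2.2
      · exact .inr ⟨r, hr.2.2, rfl⟩
  · rw [disjoint_left]
    intro v hv hv'
    simp only [mem_union, mem_image, mem_insert, mem_singleton, mem_erase] at hv hv'
    rcases hv' with ⟨h1, h2, h3⟩ | ⟨r, ⟨h1, h2, h3⟩, rfl⟩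
    · rcases hv with rfl | rfl | rfl | rfl
      · exact h.notMem x hxR (hBR h3)
      · exact h2 rfl
      · exact h1 rfl
      · exact h.notMem y hyR (hBR h3)
    · have hrR := hBR h3
      rcases hv with e | e | e | e
      · exact h2 (h.inj hrR hxR e)
      · exact h.notMem r hrR (e ▸ hxR)
      · exact h.notMem r hrR (e ▸ hyR)
      · exact h1 (h.inj hrR hyR e)

theorem sdiff_image_eq (h : Corona H C R p) (hB : B ⊆ R) :
    C \ (B ∪ B.image p) = (R \ B) ∪ (R \ B).image p := by
  ext v
  simp only [h.eq, mem_sdiff, mem_union, mem_image]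
  constructor
  · rintro ⟨hv | ⟨r, hr, rfl⟩, h2⟩
    · exact .inl ⟨hv, fun h => h2 (.inl h)⟩
    · exact .inr ⟨r, ⟨hr, fun h => h2 (.inr ⟨r, h, rfl⟩)⟩, rfl⟩
  · rintro (⟨hv, hvB⟩ | ⟨r, ⟨hr, hrB⟩, rfl⟩)
    · refine ⟨.inl hv, ?_⟩
      rintro (h2 | ⟨r, hr, rfl⟩)
      · exact hvB h2
      · exact h.notMem r (hB hr) hv
    · refine ⟨.inr ⟨r, hr, rfl⟩, ?_⟩
      rintro (h2 | ⟨s, hs, e⟩)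
      · exact h.notMem r hr (hB h2)
      · exact hrB (h.inj (hB hs) hr e ▸ hs)

theorem tiled_sdiff_pair (h : Corona H C R p) {u : V} (hu : u ∈ R) :
    Tiled H (C \ {u, p u}) := by
  have h1 : ({u, p u} : Finset V) = {u} ∪ ({u} : Finset V).image p := by ext; simp
  rw [h1, h.sdiff_image_eq (by simpa using hu), sdiff_singleton_eq_erase]
  exact h.tiled_of_PM (h.fc.2 u hu) (erase_subset _ _)

end Corona

/-- Every vertex `v` of a sun with at least two vertices has a mate `v'` such that the rest of
the sun can be tiled. -/
theorem Sun.exists_mate (h : Sun H C) (hC : ¬ ∃ x, C = {x}) {v : V} (hv : v ∈ C) :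
    ∃ v' ∈ C, H.Adj v v' ∧ Tiled H (C \ {v, v'}) := by
  obtain ⟨R, p, h⟩ := h.resolve_left hC
  rcases h.cases hv with hv | ⟨r, hr, rfl⟩
  · exact ⟨p v, h.pendant_mem hv, h.adj v hv, h.tiled_sdiff_pair hv⟩
  · exact ⟨r, h.core_mem hr, (h.adj r hr).symm, pair_comm r (p r) ▸ h.tiled_sdiff_pair hr⟩

section

variable {H H' : SimpleGraph V} {X Y A B C D R S T U : Finset V} {p : V → V}

/-! ### Tilings of suns attached to further vertices -/

theorem Tiled.of_sdiff (hB : Tiled H B) (hBA : B ⊆ A) (h : Tiled H (A \ B)) : Tiled H A := by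
  have := hB.union h disjoint_sdiff
  rwa [union_sdiff_of_subset hBA] at this

/-- A sun minus a suitable path on one or two vertices starting in a given vertex is tiled. -/
theorem Sun.exists_arm (h : Sun H C) {v : V} (hv : v ∈ C) :
    ∃ l : List V, (v :: l).Nodup ∧ (v :: l).IsChain H.Adj ∧ l.length ≤ 1 ∧
      (v :: l).toFinset ⊆ C ∧ Tiled H (C \ (v :: l).toFinset) := by
  by_cases hC : ∃ x, C = {x}
  · obtain ⟨x, rfl⟩ := hC
    rw [mem_singleton] at hv
    subst hv
    exact ⟨[], by simp, by simp, by simp, by simp, by simpa using Tiled.empty⟩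
  · obtain ⟨v', hv', hadj, ht⟩ := h.exists_mate hC hv
    refine ⟨[v'], by simp [hadj.ne], by simp [hadj], by simp, ?_, by simpa using ht⟩
    intro x hx
    simp only [List.toFinset_cons, List.toFinset_nil, mem_insert, notMem_empty, or_false] at hx
    rcases hx with rfl | rfl <;> assumption

/-- A vertex together with two suns attached to it. -/
theorem tiled_star {s v v' : V} (hC : Sun H C) (hD : Sun H D) (hCD : Disjoint C D)
    (hsC : s ∉ C) (hsD : s ∉ D) (hv : v ∈ C) (hv' : v' ∈ D) (hsv : H.Adj s v)
    (hsv' : H.Adj s v') : Tiled H (insert s (C ∪ D)) := by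
  obtain ⟨l, h1, h2, h3, h4, h5⟩ := hC.exists_arm hv
  obtain ⟨l', h1', h2', h3', h4', h5'⟩ := hD.exists_arm hv'
  have hdis : ∀ x ∈ v :: l, ∀ y ∈ v' :: l', x ≠ y := by
    rintro x hx y hy rfl
    exact disjoint_left.1 hCD (h4 (List.mem_toFinset.2 hx)) (h4' (List.mem_toFinset.2 hy))
  have hsl : s ∉ v :: l := fun h => hsC (h4 (List.mem_toFinset.2 h))
  have hsl' : s ∉ v' :: l' := fun h => hsD (h4' (List.mem_toFinset.2 h))
  have hset : ((v :: l).reverse ++ s :: v' :: l').toFinset =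
      insert s ((v :: l).toFinset ∪ (v' :: l').toFinset) := by
    ext x; simp; tauto
  have hp : Tiled H (insert s ((v :: l).toFinset ∪ (v' :: l').toFinset)) := by
    rw [← hset]
    apply Tiled.path
    · rw [List.nodup_append]
      refine ⟨List.nodup_reverse.2 h1, List.nodup_cons.2 ⟨hsl', h1'⟩, ?_⟩
      intro x hx y hy
      rw [List.mem_reverse] at hx
      rcases List.mem_cons.1 hy with rfl | hy
      · rintro rfl; exact hsl hx
      · exact hdis x hx y hy
    · rw [List.isChain_append]
      refine ⟨?_, ?_, ?_⟩
      · rw [List.isChain_reverse]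
        exact h2.imp fun _ _ h => h.symm
      · exact List.isChain_cons_cons.2 ⟨hsv', h2'⟩
      · intro x hx y hy
        simp at hx hy
        subst hx hy
        exact hsv.symm
    · simp; omega
    · simp; omega
  refine hp.of_sdiff (insert_subset_insert _ (union_subset_union h4 h4')) ?_
  convert h5.union h5' (disjoint_of_subset_left sdiff_subset
    (disjoint_of_subset_right sdiff_subset hCD)) using 1
  ext x
  simp only [mem_sdiff, mem_insert, mem_union]
  constructor
  · rintro ⟨rfl | hx | hx, h⟩ <;> tauto
  · rintro (⟨hx, h⟩ | ⟨hx, h⟩)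
    · refine ⟨.inr (.inl hx), ?_⟩
      rintro (rfl | h' | h')
      · exact hsC hx
      · exact h h'
      · exact disjoint_left.1 hCD hx (h4' h')
    · refine ⟨.inr (.inr hx), ?_⟩
      rintro (rfl | hx' | hx')
      · exact hsD hx
      · exact disjoint_left.1 hCD (h4 hx') hx
      · exact h hx'

/-- A vertex together with a sun on at least two vertices attached to it. -/
theorem tiled_half_star {s v : V} (hC : Sun H C) (hC1 : ¬ ∃ x, C = {x}) (hsC : s ∉ C)
    (hv : v ∈ C) (hsv : H.Adj s v) : Tiled H (insert s C) := by
  obtain ⟨v', hv', hadj, ht⟩ := hC.exists_mate hC1 hv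
  have h3 : Tiled H {s, v, v'} := tiled_three hsv hadj (by rintro rfl; exact hsC hv')
  refine h3.of_sdiff (insert_subset_insert _ ?_) ?_
  · intro x hx
    rcases mem_insert.1 hx with rfl | hx
    · exact hv
    · rw [mem_singleton] at hx; exact hx ▸ hv'
  · convert ht using 1
    ext x
    simp only [mem_sdiff, mem_insert]
    constructor
    · tauto
    · rintro ⟨hx, h⟩
      exact ⟨.inr hx, by rintro (rfl | hx'); exacts [hsC hx, h hx']⟩

/-- A path `w, s, w', s'` extended by a sun attached to `s'`. -/
theorem tiled_long_arm {w s w' s' v : V} (hD : Sun H D) (hv : v ∈ D) (h1 : H.Adj w s)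
    (h2 : H.Adj s w') (h3 : H.Adj w' s') (h4 : H.Adj s' v) (hww : w ≠ w') (hws : w ≠ s')
    (hss : s ≠ s') (hwD : w ∉ D) (hsD : s ∉ D) (hwD' : w' ∉ D) (hsD' : s' ∉ D) :
    Tiled H ({w, s, w', s'} ∪ D) := by
  by_cases hD1 : ∃ x, D = {x}
  · obtain ⟨x, rfl⟩ := hD1
    rw [mem_singleton] at hv hwD hsD hwD' hsD'
    subst hv
    convert tiled_five h1 h2 h3 h4 hww hws hwD hss hsD hwD' using 1
    ext; simp
  · convert (tiled_three h1 h2 hww).union (tiled_half_star hD hD1 hsD' hv h4) ?_ using 1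
    · ext; simp; tauto
    · rw [disjoint_left]
      intro x hx
      simp only [mem_insert, mem_singleton] at hx ⊢
      rcases hx with rfl | rfl | rfl
      · tauto
      · tauto
      · simp [h3.ne, hwD']

/-! ### Counting sun components -/

open Classical in
/-- The vertices of `S` that are adjacent to `C`. -/
noncomputable def nbr (H : SimpleGraph V) (S C : Finset V) : Finset V :=
  S.filter fun s => ∃ c ∈ C, H.Adj s c

theorem mem_nbr {s : V} : s ∈ nbr H S C ↔ s ∈ S ∧ ∃ c ∈ C, H.Adj s c := by
  simp [nbr]

theorem nbr_subset : nbr H S C ⊆ S := fun _ h => (mem_nbr.1 h).1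

theorem Comp.of_nbr (h : Comp H (A \ S) C) (hUS : U ⊆ S) (hN : nbr H S C ⊆ U) :
    Comp H (A \ U) C := by
  refine h.of_closed (h.sub.trans (sdiff_subset_sdiff subset_rfl hUS)) fun x hx y hy hxy => ?_
  rw [mem_sdiff] at hy
  refine h.closed x hx y (mem_sdiff.2 ⟨hy.1, fun hyS => hy.2 (hN ?_)⟩) hxy
  exact mem_nbr.2 ⟨hyS, x, hx, hxy.symm⟩

theorem mem_suns_of_nbr (h : C ∈ suns H (A \ S)) (hUS : U ⊆ S) (hN : nbr H S C ⊆ U) :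
    C ∈ suns H (A \ U) := by
  rw [mem_suns] at h ⊢
  exact ⟨h.1.of_nbr hUS hN, h.2⟩

/-- A family of sun components of `A \ S` stays a family of sun components after putting back
the part of `S` it is not adjacent to. -/
theorem card_le_card_suns {K : Finset (Finset V)} (hK : K ⊆ suns H (A \ S)) (hUS : U ⊆ S)
    (hN : ∀ C ∈ K, nbr H S C ⊆ U) : K.card ≤ (suns H (A \ U)).card :=
  card_le_card fun C hC => mem_suns_of_nbr (hK hC) hUS (hN C hC)

theorem card_suns_add_le {Y : Finset (Finset V)} (hY : Y ⊆ suns H (A \ S)) (hBA : B ⊆ A \ S)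
    (hB : Closed H (A \ S) B) (hYB : ∀ C ∈ Y, Disjoint C B) (hT : T ⊆ B) :
    (suns H (B \ T)).card + Y.card ≤ (suns H (A \ (S ∪ T))).card := by
  rw [← card_union_of_disjoint]
  · refine card_le_card fun C hC => ?_
    rcases mem_union.1 hC with hC | hC
    · rw [mem_suns] at hC ⊢
      have hCB := hC.1.sub
      refine ⟨hC.1.of_closed (hCB.trans ?_) ?_, hC.2⟩
      · intro x hx
        have := hBA (mem_sdiff.1 hx).1
        simp only [mem_sdiff, mem_union] at this hx ⊢
        tauto
      · intro x hx y hy hxy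
        simp only [mem_sdiff, mem_union, not_or] at hy
        refine hC.1.closed x hx y (mem_sdiff.2 ⟨?_, hy.2.2⟩) hxy
        exact hB x (mem_sdiff.1 (hCB hx)).1 y (mem_sdiff.2 ⟨hy.1, hy.2.1⟩) hxy
    · have h := mem_suns.1 (hY hC)
      refine mem_suns.2 ⟨h.1.anti ?_ ?_, h.2⟩
      · exact sdiff_subset_sdiff subset_rfl subset_union_left
      · intro x hx
        have := h.1.sub hx
        simp only [mem_sdiff, mem_union, not_or] at this ⊢
        exact ⟨this.1, this.2, fun hxT => disjoint_left.1 (hYB C hC) hx (hT hxT)⟩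
  · rw [disjoint_left]
    intro C hC hCY
    obtain ⟨x, hx⟩ := (mem_suns.1 hC).1.ne
    exact disjoint_left.1 (hYB C hCY) hx (mem_sdiff.1 ((mem_suns.1 hC).1.sub hx)).1

theorem Kan.of_closed (h : Kan H A) (hBA : B ⊆ A) (hB : Closed H A B) : Kan H B := by
  intro T hT
  have := card_suns_add_le (Y := ∅) (S := ∅) (H := H) (A := A) (T := T) (by simp)
    (by simpa using hBA) (by simpa using hB) (by simp) hT
  simp only [card_empty, add_zero, empty_union] at this
  exact this.trans (h T (hT.trans hBA))

/-- The part of `X` outside the members of `Y`. -/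
theorem closed_sdiff_biUnion {Y : Finset (Finset V)} (hY : ∀ C ∈ Y, Closed H X C) :
    Closed H X (X \ Y.biUnion id) := by
  refine Closed.sdiff fun x hx y hy hxy => ?_
  rw [mem_biUnion] at hx ⊢
  obtain ⟨C, hC, hx⟩ := hx
  exact ⟨C, hC, hY C hC x hx y hy hxy⟩

/-! ### Systems of representatives with capacities -/

theorem exists_assignment [Nonempty V] {ι : Type*} [DecidableEq ι] (k : ℕ) (J : Finset ι)
    (N : ι → Finset V) (S : Finset V) (hN : ∀ i ∈ J, N i ⊆ S) (hJ : J.card = k * S.card)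
    (hall : ∀ K ⊆ J, K.card ≤ k * (K.biUnion N).card) :
    ∃ g : ι → V, (∀ i ∈ J, g i ∈ N i) ∧ ∀ s ∈ S, (J.filter fun i => g i = s).card = k := by
  classical
  obtain ⟨f, hf, hft⟩ := (all_card_le_biUnion_card_iff_exists_injective
    fun i : J => N i ×ˢ (univ : Finset (Fin k))).1 (by
      intro K
      have h := hall (K.map (Function.Embedding.subtype _)) (by
        intro x hx
        obtain ⟨y, _, rfl⟩ := mem_map.1 hx
        exact y.2)
      rw [card_map] at h
      have hK : (K.biUnion fun i : J => N i ×ˢ (univ : Finset (Fin k))) =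
          ((K.map (Function.Embedding.subtype _)).biUnion N) ×ˢ univ := by
        ext ⟨a, b⟩
        simp
      rw [hK, card_product, card_univ, Fintype.card_fin]
      rwa [mul_comm])
  refine ⟨fun i => if h : i ∈ J then (f ⟨i, h⟩).1 else Classical.arbitrary V, fun i hi => ?_, ?_⟩
  · have := hft ⟨i, hi⟩
    rw [mem_product] at this
    simpa [hi] using this.1
  set g : ι → V := fun i => if h : i ∈ J then (f ⟨i, h⟩).1 else Classical.arbitrary V with hg
  have hle : ∀ s ∈ S, (J.filter fun i => g i = s).card ≤ k := by
    intro s _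
    have h1 : ((J.attach.filter fun i => (f i).1 = s).image fun i => (f i).2).card ≤ k := by
      simpa using card_le_univ ((J.attach.filter fun i => (f i).1 = s).image fun i => (f i).2)
    rw [card_image_of_injOn] at h1
    · refine le_of_eq_of_le ?_ h1
      symm
      refine card_bij (fun i _ => i.1) ?_ ?_ ?_
      · intro i hi
        simp only [mem_filter, mem_attach, true_and] at hi
        simp [hg, hi]
      · intro i _ j _ h
        exact Subtype.ext h
      · intro i hi
        rw [mem_filter] at hi
        exact ⟨⟨i, hi.1⟩, by simpa [hg, hi.1] using hi.2, rfl⟩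
    · intro i hi j hj hij
      simp only [coe_filter, mem_attach, true_and, Set.mem_ofPred_eq] at hi hj
      exact hf (Prod.ext (hi.trans hj.symm) hij)
  have hsum : J.card = ∑ s ∈ S, (J.filter fun i => g i = s).card := by
    refine card_eq_sum_card_fiberwise fun i hi => ?_
    have := hft ⟨i, hi⟩
    rw [mem_product] at this
    have h2 := hN i hi this.1
    simp only [hg]
    rw [dif_pos (mem_coe.1 hi)]
    exact h2
  have heq : ∑ s ∈ S, (J.filter fun i => g i = s).card = ∑ s ∈ S, k := by
    rw [← hsum, hJ, sum_const, smul_eq_mul, mul_comm]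
  exact (sum_eq_sum_iff_of_le hle).1 heq

end

section

variable {H H' : SimpleGraph V} {X A B C D R S T U : Finset V} {p : V → V}
variable {Y : Finset (Finset V)}

/-! ### Minimal counterexamples -/

/-- A system of vertices, each of which has exactly two suns attached to it, is tiled. -/
theorem tiled_stars (hY : Y ⊆ suns H X) (hSX : Disjoint S X) {g : Finset V → V}
    (hg : ∀ C ∈ Y, g C ∈ S) (hadj : ∀ C ∈ Y, ∃ v ∈ C, H.Adj (g C) v)
    (h2 : ∀ s ∈ S, (Y.filter fun C => g C = s).card = 2) : Tiled H (S ∪ Y.biUnion id) := by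
  have hX : ∀ C ∈ Y, C ⊆ X := fun C hC => (mem_suns.1 (hY hC)).1.sub
  have hdj : ∀ C ∈ Y, ∀ D ∈ Y, C ≠ D → Disjoint C D := fun C hC D hD =>
    (mem_suns.1 (hY hC)).1.disjoint (mem_suns.1 (hY hD)).1
  have key : S ∪ Y.biUnion id =
      S.biUnion fun s => insert s ((Y.filter fun C => g C = s).biUnion id) := by
    ext x
    simp only [mem_union, mem_biUnion, id, mem_insert, mem_filter]
    constructor
    · rintro (hx | ⟨C, hC, hx⟩)
      · exact ⟨x, hx, .inl rfl⟩
      · exact ⟨g C, hg C hC, .inr ⟨C, ⟨hC, rfl⟩, hx⟩⟩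
    · rintro ⟨s, hs, rfl | ⟨C, hC, hx⟩⟩
      · exact .inl hs
      · exact .inr ⟨C, hC.1, hx⟩
  rw [key]
  refine Tiled.biUnion _ _ (fun s hs => ?_) (fun s hs t ht hst => ?_)
  · obtain ⟨C, D, hCD, h⟩ := card_eq_two.1 (h2 s hs)
    rw [h]
    have hC : C ∈ Y.filter fun C => g C = s := by simp [h]
    have hD : D ∈ Y.filter fun C => g C = s := by simp [h]
    rw [mem_filter] at hC hD
    obtain ⟨v, hv, hsv⟩ := hadj C hC.1
    obtain ⟨v', hv', hsv'⟩ := hadj D hD.1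
    rw [hC.2] at hsv
    rw [hD.2] at hsv'
    have := tiled_star (mem_suns.1 (hY hC.1)).2 (mem_suns.1 (hY hD.1)).2
      (hdj C hC.1 D hD.1 hCD) (fun h => disjoint_left.1 hSX hs (hX C hC.1 h))
      (fun h => disjoint_left.1 hSX hs (hX D hD.1 h)) hv hv' hsv hsv'
    simpa [biUnion_insert] using this
  · rw [disjoint_left]
    intro x hx hx'
    simp only [mem_biUnion, id, mem_insert, mem_filter] at hx hx'
    rcases hx with rfl | ⟨C, ⟨hC, hCs⟩, hxC⟩ <;> rcases hx' with rfl | ⟨D, ⟨hD, hDt⟩, hxD⟩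
    · exact hst rfl
    · exact disjoint_left.1 hSX hs (hX D hD hxD)
    · exact disjoint_left.1 hSX ht (hX C hC hxC)
    · by_cases e : C = D
      · exact hst (by rw [← hCs, ← hDt, e])
      · exact disjoint_left.1 (hdj C hC D hD e) hxC hxD

/-- `H[A]` is a minimal counterexample to the sufficiency of Kaneko's condition. -/
structure MinCex (H : SimpleGraph V) (A : Finset V) : Prop where
  ih : ∀ H' A', H' ≤ H → A' ⊆ A → (A' ≠ A ∨ H' ≠ H) → Kan H' A' → Tiled H' A'
  kan : Kan H A
  not_tiled : ¬ Tiled H A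

/-- `w` is a vertex of degree one in `H[A]`, and `s` is its neighbour. -/
structure Leaf (H : SimpleGraph V) (A : Finset V) (s w : V) : Prop where
  mem : w ∈ A
  adj : H.Adj s w
  uniq : ∀ y ∈ A, H.Adj w y → y = s

theorem Leaf.mem_suns {s w : V} (h : Leaf H A s w) (hs : s ∈ S) (hw : w ∉ S) :
    {w} ∈ suns H (A \ S) := by
  refine Kaneko.mem_suns.2 ⟨comp_singleton (mem_sdiff.2 ⟨h.mem, hw⟩) ?_, sun_singleton w⟩
  intro y hy hwy
  rw [mem_sdiff] at hy
  exact hy.2 (h.uniq y hy.1 hwy ▸ hs)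

namespace MinCex

theorem conn (h : MinCex H A) : Comp H A A := by
  have hA : A.Nonempty := by
    rw [nonempty_iff_ne_empty]
    rintro rfl
    exact h.not_tiled .empty
  obtain ⟨x, hx⟩ := hA
  obtain ⟨C, hC, -⟩ := exists_comp (H := H) hx
  by_contra hne
  have hCA : C ≠ A := by rintro rfl; exact hne hC
  have h1 := h.ih H C le_rfl hC.sub (.inl hCA) (h.kan.of_closed hC.sub hC.closed)
  have hC' : A \ C ≠ A := by
    intro e
    obtain ⟨y, hy⟩ := hC.ne
    have := hC.sub hy
    rw [← e, mem_sdiff] at this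
    exact this.2 hy
  have h2 := h.ih H (A \ C) le_rfl sdiff_subset (.inl hC')
    (h.kan.of_closed sdiff_subset hC.closed.sdiff)
  exact h.not_tiled (h1.of_sdiff hC.sub h2)

theorem not_sun (h : MinCex H A) : ¬ Sun H A := by
  intro hs
  have h1 := h.kan ∅ (empty_subset _)
  rw [sdiff_empty, card_empty, mul_zero, nonpos_iff_eq_zero, card_eq_zero] at h1
  have : A ∈ suns H A := mem_suns.2 ⟨h.conn, hs⟩
  simp [h1] at this

/-- The rest of `A`, after removing `S` and all sun components of `A \ S`, is tiled. -/
theorem tiled_of_closed (h : MinCex H A) (hS : S ⊆ A) (hne : S.Nonempty)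
    (hBA : B ⊆ A \ S) (hB : Closed H (A \ S) B)
    (hYB : ∀ C ∈ suns H (A \ S), Disjoint C B)
    (hle : ∀ T ⊆ B, (suns H (A \ (S ∪ T))).card ≤ (suns H (A \ S)).card + 2 * T.card) :
    Tiled H B := by
  refine h.ih H B le_rfl (hBA.trans sdiff_subset) (.inl ?_) fun T hT => ?_
  · rintro rfl
    obtain ⟨s, hs⟩ := hne
    exact (mem_sdiff.1 (hBA (hS hs))).2 hs
  · have h1 := card_suns_add_le subset_rfl hBA hB hYB hT
    have h2 := hle T hT
    omega

theorem disjoint_rest : ∀ C ∈ suns H X, Disjoint C (X \ (suns H X).biUnion id) := by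
  intro C hC
  rw [disjoint_left]
  intro x hx hx'
  exact (mem_sdiff.1 hx').2 (mem_biUnion.2 ⟨C, hC, hx⟩)

theorem not_tiled_stars_of_le (h : MinCex H A) (hS : S ⊆ A) (hne : S.Nonempty)
    (hle : ∀ T, T ⊆ A \ S → (suns H (A \ (S ∪ T))).card ≤ (suns H (A \ S)).card + 2 * T.card) :
    ¬ Tiled H (S ∪ (suns H (A \ S)).biUnion id) := by
  intro ht
  have hrest := h.tiled_of_closed (B := (A \ S) \ (suns H (A \ S)).biUnion id) hS hne
    sdiff_subset (closed_sdiff_biUnion fun C hC => (mem_suns.1 hC).1.closed) disjoint_rest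
    fun T hT => hle T (hT.trans sdiff_subset)
  refine h.not_tiled (ht.of_sdiff (union_subset hS ?_) ?_)
  · rw [biUnion_subset]
    exact fun C hC => (mem_suns.1 hC).1.sub.trans sdiff_subset
  · have e : A \ (S ∪ (suns H (A \ S)).biUnion id) = (A \ S) \ (suns H (A \ S)).biUnion id := by
      ext x
      simp only [mem_sdiff, mem_union]
      tauto
    rw [e]
    exact hrest

theorem biUnion_nbr_subset {K : Finset (Finset V)} : K.biUnion (nbr H S) ⊆ S :=
  biUnion_subset.2 fun _ _ => nbr_subset

theorem strict (h : MinCex H A) (hS : S ⊆ A) (hne : S.Nonempty) :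
    (suns H (A \ S)).card + 1 ≤ 2 * S.card := by
  have hle := h.kan S hS
  by_contra hlt
  have htight : (suns H (A \ S)).card = 2 * S.card := by omega
  have : Nonempty V := ⟨hne.choose⟩
  obtain ⟨g, hg, hg2⟩ := exists_assignment 2 (suns H (A \ S)) (nbr H S) S
    (fun _ _ => nbr_subset) htight fun K hK =>
      (card_le_card_suns hK biUnion_nbr_subset fun C hC => subset_biUnion_of_mem _ hC).trans
        (h.kan _ (biUnion_nbr_subset.trans hS))
  refine h.not_tiled_stars_of_le hS hne (fun T hT => ?_)
    (tiled_stars subset_rfl disjoint_sdiff (fun C hC => nbr_subset (hg C hC))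
      (fun C hC => (mem_nbr.1 (hg C hC)).2) hg2)
  have h1 := h.kan (S ∪ T) (union_subset hS (hT.trans sdiff_subset))
  have h2 := card_union_le S T
  omega

theorem not_tiled_stars (h : MinCex H A) (hS : S ⊆ A)
    (hsl : (suns H (A \ S)).card + 1 = 2 * S.card) :
    ¬ Tiled H (S ∪ (suns H (A \ S)).biUnion id) := by
  have hne : S.Nonempty := by
    rw [nonempty_iff_ne_empty]; rintro rfl; simp at hsl
  refine h.not_tiled_stars_of_le hS hne fun T hT => ?_
  have h1 := h.strict (union_subset hS (hT.trans sdiff_subset)) (hne.mono subset_union_left)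
  have h2 := card_union_le S T
  omega

/-- In a set `S` with `2|S| - 1` sun components, all suns except `C₀` can be distributed over
`S \ {s₀}`. -/
theorem exists_assignment_erase (h : MinCex H A) (hS : S ⊆ A)
    (hsl : (suns H (A \ S)).card + 1 = 2 * S.card) {s₀ : V} (hs₀ : s₀ ∈ S) {C₀ : Finset V}
    (hC₀ : C₀ ∈ suns H (A \ S))
    (hblock : ∀ K ⊆ (suns H (A \ S)).erase C₀, s₀ ∈ K.biUnion (nbr H S) →
      K.card + 2 ≤ 2 * (K.biUnion (nbr H S)).card) :
    ∃ g : Finset V → V, (∀ C ∈ (suns H (A \ S)).erase C₀, g C ∈ nbr H (S.erase s₀) C) ∧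
      ∀ s ∈ S.erase s₀,
        (((suns H (A \ S)).erase C₀).filter fun C => g C = s).card = 2 := by
  have : Nonempty V := ⟨s₀⟩
  have hnbr : ∀ C, nbr H (S.erase s₀) C = (nbr H S C).erase s₀ := by
    intro C; ext x; simp only [mem_nbr, mem_erase]; tauto
  refine exists_assignment 2 _ (nbr H (S.erase s₀)) _ (fun _ _ => nbr_subset) ?_ ?_
  · have h1 := card_erase_add_one hC₀
    have h2 := card_erase_add_one hs₀
    omega
  · intro K hK
    have hU : K.biUnion (nbr H (S.erase s₀)) = (K.biUnion (nbr H S)).erase s₀ := by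
      ext x; simp only [mem_biUnion, hnbr, mem_erase]; tauto
    rw [hU]
    by_cases hs : s₀ ∈ K.biUnion (nbr H S)
    · have := hblock K hK hs
      have h2 := card_erase_add_one hs
      omega
    · rw [erase_eq_of_notMem hs]
      exact (card_le_card_suns (hK.trans (erase_subset _ _)) biUnion_nbr_subset
        fun C hC => subset_biUnion_of_mem _ hC).trans (h.kan _ (biUnion_nbr_subset.trans hS))

theorem exists_leaf (h : MinCex H A) (hS : S ⊆ A)
    (hsl : (suns H (A \ S)).card + 1 = 2 * S.card) {s₀ : V} (hs₀ : s₀ ∈ S) :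
    ∃ w, Leaf H A s₀ w := by
  classical
  -- pass to a smallest such set containing `s₀`
  obtain ⟨S', hS', hmin⟩ := exists_min_image (A.powerset.filter fun S =>
    s₀ ∈ S ∧ (suns H (A \ S)).card + 1 = 2 * S.card) card ⟨S, by simp [hS, hs₀, hsl]⟩
  clear! S
  rename' S' => S
  simp only [mem_filter, mem_powerset] at hS' hmin
  obtain ⟨hS, hs₀, hsl⟩ := hS'
  have hXS : Disjoint S (A \ S) := disjoint_sdiff
  have hsub : ∀ C ∈ suns H (A \ S), C ⊆ A \ S := fun C hC => (mem_suns.1 hC).1.sub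
  have hnot : ∀ C ∈ suns H (A \ S), ∀ s ∈ S, s ∉ C := fun C hC s hs hsC =>
    (mem_sdiff.1 (hsub C hC hsC)).2 hs
  have hdj : ∀ C ∈ suns H (A \ S), ∀ D ∈ suns H (A \ S), C ≠ D → Disjoint C D :=
    fun C hC D hD => (mem_suns.1 hC).1.disjoint (mem_suns.1 hD).1
  have hassign : ∀ C₀ ∈ suns H (A \ S), ∃ g : Finset V → V,
      (∀ C ∈ (suns H (A \ S)).erase C₀, g C ∈ nbr H (S.erase s₀) C) ∧
      ∀ s ∈ S.erase s₀, (((suns H (A \ S)).erase C₀).filter fun C => g C = s).card = 2 := by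
    intro C₀ hC₀
    refine h.exists_assignment_erase hS hsl hs₀ hC₀ fun K hK hs => ?_
    have hUS : K.biUnion (nbr H S) ⊆ S := biUnion_nbr_subset
    have h1 := card_le_card_suns (hK.trans (erase_subset _ _)) hUS
      fun C hC => subset_biUnion_of_mem _ hC
    have h2 := h.strict (hUS.trans hS) ⟨_, hs⟩
    by_contra hlt
    have h3 := hmin _ ⟨hUS.trans hS, hs, by omega⟩
    have h4 := card_le_card hK
    have h5 := card_erase_add_one hC₀
    omega
  -- every sun attached to `s₀` is a single vertex
  have hsingle : ∀ C₀ ∈ suns H (A \ S), (∃ v ∈ C₀, H.Adj s₀ v) → ∃ x, C₀ = {x} := by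
    rintro C₀ hC₀ ⟨v, hv, hsv⟩
    by_contra hC1
    obtain ⟨g, hg, hg2⟩ := hassign C₀ hC₀
    have h1 := tiled_stars (erase_subset _ _) (disjoint_of_subset_left (erase_subset s₀ S) hXS)
      (fun C hC => nbr_subset (hg C hC)) (fun C hC => (mem_nbr.1 (hg C hC)).2) hg2
    have h2 := tiled_half_star (mem_suns.1 hC₀).2 hC1 (hnot C₀ hC₀ s₀ hs₀) hv hsv
    refine h.not_tiled_stars hS hsl ?_
    convert h1.union h2 ?_ using 1
    · ext x
      simp only [mem_union, mem_biUnion, id, mem_erase, mem_insert]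
      constructor
      · rintro (hx | ⟨C, hC, hx⟩)
        · by_cases e : x = s₀ <;> simp [e, hx]
        · by_cases e : C = C₀
          · simp [← e, hx]
          · exact .inl (.inr ⟨C, ⟨e, hC⟩, hx⟩)
      · rintro ((hx | ⟨C, hC, hx⟩) | rfl | hx)
        · exact .inl hx.2
        · exact .inr ⟨C, hC.2, hx⟩
        · exact .inl hs₀
        · exact .inr ⟨C₀, hC₀, hx⟩
    · rw [disjoint_left]
      intro x hx hx₀
      simp only [mem_union, mem_biUnion, id, mem_erase, mem_insert] at hx hx₀
      rcases hx with hx | ⟨C, hC, hx⟩ <;> rcases hx₀ with rfl | hx₀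
      · exact hx.1 rfl
      · exact hnot C₀ hC₀ x hx.2 hx₀
      · exact hnot C hC.2 x hs₀ hx
      · exact disjoint_left.1 (hdj C hC.2 C₀ hC₀ hC.1) hx hx₀
  -- the suns attached to `s₀`
  have hmany : ∀ K ⊆ suns H (A \ S), (∀ C ∈ K, ¬ ∃ v ∈ C, H.Adj s₀ v) →
      K.card ≤ (suns H (A \ S.erase s₀)).card := by
    intro K hK hadj
    refine card_le_card_suns hK (erase_subset _ _) fun C hC s hs => ?_
    rw [mem_nbr] at hs
    refine mem_erase.2 ⟨?_, hs.1⟩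
    rintro rfl
    exact hadj C hC hs.2
  have hScard := card_erase_add_one hs₀
  obtain ⟨C₀, hC₀, v₀, hv₀, hsv₀⟩ : ∃ C₀ ∈ suns H (A \ S), ∃ v ∈ C₀, H.Adj s₀ v := by
    by_contra hcon
    push Not at hcon
    have h1 := hmany _ subset_rfl fun C hC => by push Not; exact hcon C hC
    have h2 := h.kan (S.erase s₀) ((erase_subset _ _).trans hS)
    omega
  obtain ⟨w, rfl⟩ := hsingle C₀ hC₀ ⟨v₀, hv₀, hsv₀⟩
  rw [mem_singleton] at hv₀
  subst hv₀
  rcases (S.erase s₀).eq_empty_or_nonempty with hSe | hSne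
  · have hw := (mem_suns.1 hC₀).1
    have hvA := hw.sub (mem_singleton_self _)
    refine ⟨v₀, (mem_sdiff.1 hvA).1, hsv₀, fun y hy hvy => ?_⟩
    by_contra hys
    have hyS : y ∉ S := fun hyS => by
      have := mem_erase.2 ⟨hys, hyS⟩
      simp [hSe] at this
    have := hw.closed v₀ (mem_singleton_self _) y (mem_sdiff.2 ⟨hy, hyS⟩) hvy
    exact hvy.ne (mem_singleton.1 this).symm
  · exfalso
    obtain ⟨C₁, hC₁, hadj₁⟩ : ∃ C₁ ∈ (suns H (A \ S)).erase {v₀}, ∃ v ∈ C₁, H.Adj s₀ v := by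
      by_contra hcon
      push Not at hcon
      have h1 := hmany _ (erase_subset _ _) fun C hC => by push Not; exact hcon C hC
      have h2 := h.strict ((erase_subset _ _).trans hS) hSne
      have h3 := card_erase_add_one hC₀
      omega
    have hC₁' := mem_of_mem_erase hC₁
    obtain ⟨w', rfl⟩ := hsingle C₁ hC₁' hadj₁
    obtain ⟨v₁, hv₁, hsv₁⟩ := hadj₁
    rw [mem_singleton] at hv₁
    subst hv₁
    obtain ⟨g, hg, hg2⟩ := hassign _ hC₀
    set Z := (suns H (A \ S)).erase {v₀} with hZ
    have hg₁ := mem_nbr.1 (hg _ hC₁)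
    set s₁ := g {v₁} with hs₁
    obtain ⟨C₂, hC₂, hC₂e⟩ : ∃ C₂, C₂ ∈ Z.filter (fun C => g C = s₁) ∧ C₂ ≠ {v₁} :=
      exists_mem_ne (by rw [hg2 s₁ hg₁.1]; norm_num) _
    rw [mem_filter] at hC₂
    have hC₂' := mem_of_mem_erase hC₂.1
    have hfib : ∀ C ∈ Z, g C = s₁ → C = {v₁} ∨ C = C₂ := by
      intro C hC hCs
      by_contra hcon
      push Not at hcon
      have hsubs : ({{v₁}, C₂, C} : Finset (Finset V)) ⊆ Z.filter (fun C => g C = s₁) := by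
        intro D hD
        simp only [mem_insert, mem_singleton] at hD
        rcases hD with rfl | rfl | rfl
        · exact mem_filter.2 ⟨hC₁, rfl⟩
        · exact mem_filter.2 hC₂
        · exact mem_filter.2 ⟨hC, hCs⟩
      have h1 := card_le_card hsubs
      rw [hg2 s₁ hg₁.1, card_eq_three.2 ⟨_, _, _, hC₂e.symm, hcon.1.symm, hcon.2.symm, rfl⟩] at h1
      omega
    have hs₁S := mem_of_mem_erase hg₁.1
    have hs₁ne := ne_of_mem_erase hg₁.1
    -- the untouched stars
    have ht1 : Tiled H ((S.erase s₀).erase s₁ ∪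
        (Z.filter fun C => g C ≠ s₁).biUnion id) := by
      refine tiled_stars (X := A \ S) (g := g)
        ((filter_subset _ _).trans (erase_subset _ _))
        (disjoint_of_subset_left ((erase_subset _ _).trans (erase_subset s₀ S)) hXS) ?_ ?_ ?_
      · intro C hC
        rw [mem_filter] at hC
        exact mem_erase.2 ⟨hC.2, nbr_subset (hg C hC.1)⟩
      · intro C hC
        exact (mem_nbr.1 (hg C (mem_filter.1 hC).1)).2
      · intro s hs
        rw [filter_filter, ← hg2 s (mem_of_mem_erase hs)]
        congr 1
        refine filter_congr fun C _ => ⟨fun h => h.2, fun h => ⟨?_, h⟩⟩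
        rw [h]; exact ne_of_mem_erase hs
    obtain ⟨v₂, hv₂, hsv₂⟩ := (mem_nbr.1 (hg _ hC₂.1)).2
    rw [hC₂.2] at hsv₂
    obtain ⟨v₁', hv₁', hsv₁'⟩ := hg₁.2
    rw [mem_singleton] at hv₁'
    subst hv₁'
    have hv₀₁ : v₀ ≠ v₁' := by
      rintro rfl
      exact ne_of_mem_erase hC₁ rfl
    have hv₀A := hnot _ hC₀
    have hv₁A := hnot _ hC₁'
    simp only [mem_singleton] at hv₀A hv₁A
    have hv₀C₂ : v₀ ∉ C₂ := disjoint_singleton_left.1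
      (hdj _ hC₀ _ hC₂' (ne_of_mem_erase hC₂.1).symm)
    have hv₁C₂ : v₁' ∉ C₂ := disjoint_singleton_left.1 (hdj _ hC₁' _ hC₂' hC₂e.symm)
    have ht2 : Tiled H ({v₀, s₀, v₁', s₁} ∪ C₂) :=
      tiled_long_arm (mem_suns.1 hC₂').2 hv₂ hsv₀.symm hsv₁ hsv₁'.symm hsv₂ hv₀₁
        (fun e => hv₀A _ hs₁S e.symm) hs₁ne.symm hv₀C₂ (hnot _ hC₂' _ hs₀) hv₁C₂
        (hnot _ hC₂' _ hs₁S)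
    refine h.not_tiled_stars hS hsl ?_
    convert ht1.union ht2 ?_ using 1
    · ext x
      simp only [mem_union, mem_biUnion, id, mem_erase, mem_insert, mem_singleton, mem_filter]
      constructor
      · rintro (hx | ⟨C, hC, hx⟩)
        · by_cases e : x = s₀
          · simp [e]
          · by_cases e' : x = s₁
            · simp [e']
            · simp [e, e', hx]
        · by_cases e : C = {v₀}
          · subst e; simp [mem_singleton.1 hx]
          · have hCZ : C ∈ Z := mem_erase.2 ⟨e, hC⟩
            by_cases e' : g C = s₁
            · rcases hfib C hCZ e' with rfl | rfl
              · simp [mem_singleton.1 hx]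
              · exact .inr (.inr hx)
            · exact .inl (.inr ⟨C, ⟨hCZ, e'⟩, hx⟩)
      · rintro ((hx | ⟨C, hC, hx⟩) | (rfl | rfl | rfl | rfl) | hx)
        · exact .inl hx.2.2
        · exact .inr ⟨C, mem_of_mem_erase hC.1, hx⟩
        · exact .inr ⟨_, hC₀, mem_singleton_self _⟩
        · exact .inl hs₀
        · exact .inr ⟨_, hC₁', mem_singleton_self _⟩
        · exact .inl hs₁S
        · exact .inr ⟨_, hC₂', hx⟩
    · rw [disjoint_left]
      intro x hx hx'
      simp only [mem_union, mem_biUnion, id, mem_erase, mem_insert, mem_singleton,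
        mem_filter] at hx hx'
      rcases hx with ⟨h1, h2, hx⟩ | ⟨C, ⟨hC, hgC⟩, hx⟩
      · rcases hx' with (rfl | rfl | rfl | rfl) | hx'
        · exact hv₀A _ hx rfl
        · exact h2 rfl
        · exact hv₁A _ hx rfl
        · exact h1 rfl
        · exact hnot _ hC₂' _ hx hx'
      · have hCm := mem_of_mem_erase hC
        rcases hx' with (rfl | rfl | rfl | rfl) | hx'
        · exact disjoint_left.1 (hdj _ hCm _ hC₀ (ne_of_mem_erase hC)) hx (mem_singleton_self _)
        · exact hnot _ hCm _ hs₀ hx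
        · refine disjoint_left.1 (hdj _ hCm _ hC₁' ?_) hx (mem_singleton_self _)
          rintro rfl; exact hgC rfl
        · exact hnot _ hCm _ hs₁S hx
        · refine disjoint_left.1 (hdj _ hCm _ hC₂' ?_) hx hx'
          rintro rfl; exact hgC hC₂.2

end MinCex

end

section

variable {H H' : SimpleGraph V} {X A B C D R S T U : Finset V} {p : V → V}
variable {Y : Finset (Finset V)}

namespace MinCex

theorem exists_slack_one (h : MinCex H A) :
    ∃ S ⊆ A, (suns H (A \ S)).card + 1 = 2 * S.card := by
  by_contra! hno
  have hs2 : ∀ S ⊆ A, S.Nonempty → (suns H (A \ S)).card + 2 ≤ 2 * S.card := fun S hS hne => by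
    have h1 := h.strict hS hne
    have h2 := hno S hS
    omega
  have hsing : ∀ v ∈ A, ∀ C, C ∉ suns H (A \ {v}) := fun v hv C hC => by
    have h1 := hs2 {v} (by simpa using hv) (by simp)
    have h2 := card_pos.2 ⟨C, hC⟩
    simp only [card_singleton] at h1
    omega
  obtain ⟨x, hx⟩ := h.conn.ne
  obtain ⟨y, hy, hxy⟩ : ∃ y ∈ A, H.Adj x y := by
    by_contra! hn
    have := h.conn.eq_of_mem (comp_singleton hx hn) hx (by simp)
    exact h.not_sun (this ▸ sun_singleton x)
  set H' := H.deleteEdges {s(x, y)} with hH'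
  have hadj : ∀ a b, H'.Adj a b ↔ H.Adj a b ∧ s(a, b) ≠ s(x, y) := fun a b => by
    simp [hH', SimpleGraph.deleteEdges_adj]
  have hle : H' ≤ H := SimpleGraph.deleteEdges_le _
  have hKan : ¬ Kan H' A := by
    intro hK
    refine h.not_tiled ((h.ih H' A hle subset_rfl (.inr fun he => ?_) hK).mono hle)
    have := (hadj x y).1 (he ▸ hxy)
    exact this.2 rfl
  have hin : ∀ {a b z : V} {C : Finset V}, a ∈ C → z ∉ C → (z = x ∨ z = y) →
      b ≠ z → (H.Adj a b ↔ H'.Adj a b) := by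
    intro a b z C ha hz hzxy hb
    rw [hadj]
    refine ⟨fun h => ⟨h, fun he => ?_⟩, And.left⟩
    have h1 : z ∈ s(a, b) := by rw [he]; simpa using hzxy
    rcases Sym2.mem_iff.1 h1 with rfl | rfl
    · exact hz ha
    · exact hb rfl
  simp only [Kan, not_forall, not_le] at hKan
  obtain ⟨S, hS, hlt⟩ := hKan
  have hS0 : S = ∅ := by
    by_contra hne
    have h1 := hs2 S hS (nonempty_iff_ne_empty.2 hne)
    have hone : ∀ z, ((suns H' (A \ S)).filter fun C => z ∈ C).card ≤ 1 := fun z => by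
      refine card_le_one.2 fun C hC D hD => ?_
      rw [mem_filter, mem_suns] at hC hD
      exact hC.1.1.eq_of_mem hD.1.1 hC.2 hD.2
    have hsub : suns H' (A \ S) ⊆ suns H (A \ S) ∪ ((suns H' (A \ S)).filter fun C => x ∈ C) ∪
        ((suns H' (A \ S)).filter fun C => y ∈ C) := by
      intro C hC
      simp only [mem_union, mem_filter, hC, true_and]
      by_contra! hn
      obtain ⟨⟨hn, hxC⟩, hyC⟩ := hn
      rw [mem_suns] at hC
      have hag : ∀ a ∈ C, ∀ b, H.Adj a b → H'.Adj a b := fun a ha b hab => by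
        rw [hadj]
        refine ⟨hab, fun he => ?_⟩
        have h1 : a ∈ s(x, y) := by rw [← he]; simp
        rcases Sym2.mem_iff.1 h1 with rfl | rfl
        · exact hxC ha
        · exact hyC ha
      refine hn (mem_suns.2 ⟨hC.1.congr hC.1.sub
        (fun a ha b hb hab => hC.1.closed a ha b hb (hag a ha b hab)) ?_, hC.2.congr ?_⟩)
      · exact fun a ha b _ => ⟨fun h => hle h, hag a ha b⟩
      · exact fun a ha b _ => ⟨fun h => hle h, hag a ha b⟩
    have h2 := card_le_card hsub
    have h3 := card_union_le (suns H (A \ S) ∪ ((suns H' (A \ S)).filter fun C => x ∈ C))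
        ((suns H' (A \ S)).filter fun C => y ∈ C)
    have h4 := card_union_le (suns H (A \ S)) ((suns H' (A \ S)).filter fun C => x ∈ C)
    have h5 := hone x
    have h6 := hone y
    omega
  subst hS0
  simp only [card_empty, mul_zero, sdiff_empty, card_pos] at hlt
  obtain ⟨C, hC⟩ := hlt
  rw [mem_suns] at hC
  have hmem : ∀ z, (z = x ∨ z = y) → z ∈ A → z ∈ C := by
    intro z hz hzA
    by_contra hzC
    have hne : ∀ b ∈ A \ {z}, b ≠ z := fun b hb => by simpa using (mem_sdiff.1 hb).2
    have hCz : C ⊆ A \ {z} := fun a ha => mem_sdiff.2 ⟨hC.1.sub ha, by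
      rw [mem_singleton]; rintro rfl; exact hzC ha⟩
    refine hsing z hzA C (mem_suns.2 ⟨hC.1.congr hCz (fun a ha b hb hab => ?_) ?_, hC.2.congr ?_⟩)
    · exact hC.1.closed a ha b (mem_sdiff.1 hb).1 ((hin ha hzC hz (hne b hb)).1 hab)
    · exact fun a ha b hb => (hin ha hzC hz (hne b (hCz hb))).symm
    · exact fun a ha b hb => (hin ha hzC hz (hne b (hCz hb))).symm
  have hxC := hmem x (.inl rfl) hx
  have hyC := hmem y (.inr rfl) hy
  have hCA : C = A := h.conn.min C hC.1.sub hC.1.ne fun a ha b hb hab => by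
    by_cases he : s(a, b) = s(x, y)
    · have h1 : b ∈ s(x, y) := by rw [← he]; simp
      rcases Sym2.mem_iff.1 h1 with rfl | rfl <;> assumption
    · exact hC.1.closed a ha b hb ((hadj a b).2 ⟨hab, he⟩)
  subst hCA
  obtain ⟨z, rfl⟩ | ⟨R, p, hR⟩ := hC.2
  · rw [mem_singleton] at hx hy
    exact hxy.ne (hx.trans hy.symm)
  have hp : ∀ v ∈ R, p v = x ∨ p v = y := by
    intro v hv
    by_contra! hn
    refine hsing v (hR.core_mem hv) {p v} (mem_suns.2 ⟨comp_singleton ?_ ?_, sun_singleton _⟩)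
    · exact mem_sdiff.2 ⟨hR.pendant_mem hv, by simpa using (hR.adj v hv).ne'⟩
    · intro b hb hab
      refine (mem_sdiff.1 hb).2 (mem_singleton.2 (hR.uniq v hv b (mem_sdiff.1 hb).1 ?_))
      rw [hadj]
      refine ⟨hab, fun he => ?_⟩
      have h1 : p v ∈ s(x, y) := by rw [← he]; simp
      rcases Sym2.mem_iff.1 h1 with h1 | h1
      · exact hn.1 h1
      · exact hn.2 h1
  have h2 : R.card ≤ 2 := by
    rw [← card_image_of_injOn hR.inj]
    refine (card_le_card (t := {x, y}) fun b hb => ?_).trans card_le_two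
    obtain ⟨v, hv, rfl⟩ := mem_image.1 hb
    simpa using hp v hv
  have h1 : R.card = 1 := by
    obtain ⟨k, hk⟩ := hR.fc.odd
    omega
  obtain ⟨v, rfl⟩ := card_eq_one.1 h1
  have hCe := hR.eq
  simp only [image_singleton] at hCe
  have hv := hR.adj v (by simp)
  rw [hCe] at hx hy
  simp only [mem_union, mem_singleton] at hx hy
  rw [hadj] at hv
  refine hv.2 ?_
  rcases hx with rfl | rfl <;> rcases hy with rfl | rfl
  · exact absurd rfl hxy.ne
  · rfl
  · exact Sym2.eq_swap
  · exact absurd rfl hxy.ne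

end MinCex

end

section

variable {H H' : SimpleGraph V} {X A B C D R S T U : Finset V} {p : V → V}
variable {Y : Finset (Finset V)}

theorem corona_pair {a b : V} (hab : H.Adj a b) : Corona H {a, b} {a} fun _ => b := by
  refine ⟨⟨by simp, ?_⟩, ?_, by simp, ?_, ?_, ?_⟩
  · intro x hx
    rw [mem_singleton] at hx
    subst hx
    simpa using PM.empty
  · ext; simp
  · intro r hr
    simpa using hab.ne'
  · intro r hr
    rw [mem_singleton] at hr
    exact hr ▸ hab
  · intro r hr y hy hby
    rw [mem_singleton] at hr
    rcases mem_insert.1 hy with rfl | hy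
    · exact hr.symm
    · rw [mem_singleton] at hy
      exact absurd hy hby.ne'

theorem sun_pair {a b : V} (hab : H.Adj a b) : Sun H {a, b} := .inr ⟨_, _, corona_pair hab⟩

theorem comp_pair {a b : V} (hab : H.Adj a b) (ha : a ∈ X) (hb : b ∈ X)
    (hcl : Closed H X {a, b}) : Comp H X {a, b} := by
  refine ⟨by simp [insert_subset_iff, ha, hb], by simp, hcl, fun B hB hne hB' => ?_⟩
  have key : ∀ {c d}, c ∈ B → d ∈ ({a, b} : Finset V) → H.Adj c d → d ∈ B :=
    fun hc hd hcd => hB' _ hc _ hd hcd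
  refine subset_antisymm hB ?_
  obtain ⟨x, hx⟩ := hne
  have hx' := hB hx
  simp only [mem_insert, mem_singleton] at hx'
  rcases hx' with rfl | rfl
  · have := key hx (by simp) hab
    simp [insert_subset_iff, hx, this]
  · have := key hx (by simp) hab.symm
    simp [insert_subset_iff, hx, this]

theorem suns_congr (hH : ∀ x ∈ X, ∀ y ∈ X, H.Adj x y ↔ H'.Adj x y) : suns H X = suns H' X := by
  ext C
  rw [mem_suns, mem_suns]
  constructor
  · rintro ⟨h1, h2⟩
    have hC := h1.sub
    exact ⟨h1.congr hC (fun x hx y hy hxy => h1.closed x hx y hy ((hH x (hC hx) y hy).2 hxy))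
      fun x hx y hy => hH x (hC hx) y (hC hy), h2.congr fun x hx y hy => hH x (hC hx) y (hC hy)⟩
  · rintro ⟨h1, h2⟩
    have hC := h1.sub
    exact ⟨h1.congr hC (fun x hx y hy hxy => h1.closed x hx y hy ((hH x (hC hx) y hy).1 hxy))
      fun x hx y hy => (hH x (hC hx) y (hC hy)).symm,
      h2.congr fun x hx y hy => (hH x (hC hx) y (hC hy)).symm⟩

/-- A vertex `s` with a leaf `w` whose only other neighbour is `v` does not lie in a sun
together with `v`. -/
theorem Sun.false_of_pendant {s w v : V} (hC : Sun H C) (hs : s ∈ C) (hw : w ∈ C) (hv : v ∈ C)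
    (hvw : v ≠ w) (hsw : H.Adj s w) (hsv : H.Adj s v) (hs' : ∀ y ∈ C, H.Adj s y → y = v ∨ y = w)
    (hw' : ∀ y ∈ C, H.Adj w y → y = s) : False := by
  obtain ⟨z, rfl⟩ | ⟨R, p, hR⟩ := hC
  · rw [mem_singleton] at hs hw
    exact hsw.ne (hs.trans hw.symm)
  rcases hR.cases hw with hwR | ⟨r, hr, rfl⟩
  · have h1 := hw' _ (hR.pendant_mem hwR) (hR.adj w hwR)
    exact hvw (hR.uniq w hwR v hv (h1 ▸ hsv))
  have hrs := hR.uniq r hr s hs hsw.symm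
  subst hrs
  rcases hR.cases hv with hvR | ⟨r', hr', rfl⟩
  · obtain ⟨z, hz, hzv, hsz⟩ := hR.fc.exists_adj hr hvR hsv.ne
    rcases hs' z (hR.core_mem hz) hsz with rfl | rfl
    · exact hzv rfl
    · exact hR.notMem s hr hz
  · exact hvw (by rw [hR.uniq r' hr' s hs hsv.symm])

/-- Attaching a path on two vertices to a set in which all nonempty subsets have slack. -/
theorem kan_pendant {s w v : V} (hD : ∀ T ⊆ D, T.Nonempty → (suns H (D \ T)).card + 1 ≤ 2 * T.card)
    (hD0 : suns H D = ∅) (hv : v ∈ D) (hs : s ∉ D) (hw : w ∉ D) (hsw : H.Adj s w)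
    (hsv : H.Adj s v) (h1 : ∀ d ∈ D, H.Adj s d → d = v) (h2 : ∀ d ∈ D, ¬ H.Adj w d) :
    Kan H (insert s (insert w D)) := by
  intro T hT
  have hw1 : ∀ y ∈ insert s (insert w D), H.Adj w y → y = s := by
    intro y hy hwy
    simp only [mem_insert] at hy
    rcases hy with rfl | rfl | hy
    · rfl
    · exact absurd rfl hwy.ne
    · exact absurd hwy (h2 y hy)
  have hs1 : ∀ y ∈ insert s (insert w D), H.Adj s y → y = v ∨ y = w := by
    intro y hy hsy
    simp only [mem_insert] at hy
    rcases hy with rfl | rfl | hy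
    · exact absurd rfl hsy.ne
    · exact .inr rfl
    · exact .inl (h1 y hy hsy)
  set Z := (suns H (insert s (insert w D) \ T)).filter fun C => s ∈ C ∨ w ∈ C with hZ
  have hboth : s ∉ T → w ∉ T → ∀ C ∈ Z, s ∈ C ∧ w ∈ C := by
    intro hsT hwT C hC
    rw [hZ, mem_filter, mem_suns] at hC
    rcases hC.2 with hC2 | hC2
    · exact ⟨hC2, hC.1.1.closed s hC2 w (by simp [hwT]) hsw⟩
    · exact ⟨hC.1.1.closed w hC2 s (by simp [hsT]) hsw.symm, hC2⟩
  have hone : Z.card ≤ 1 := by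
    refine card_le_one.2 fun C hC C' hC' => ?_
    have hc := mem_filter.1 hC
    have hc' := mem_filter.1 hC'
    have hcc := (mem_suns.1 hc.1).1
    have hcc' := (mem_suns.1 hc'.1).1
    by_cases hsT : s ∈ T
    · have : ∀ C, C ⊆ insert s (insert w D) \ T → s ∉ C := fun C hC h => (mem_sdiff.1 (hC h)).2 hsT
      exact hcc.eq_of_mem hcc' (hc.2.resolve_left (this _ hcc.sub))
        (hc'.2.resolve_left (this _ hcc'.sub))
    by_cases hwT : w ∈ T
    · have : ∀ C, C ⊆ insert s (insert w D) \ T → w ∉ C := fun C hC h => (mem_sdiff.1 (hC h)).2 hwT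
      exact hcc.eq_of_mem hcc' (hc.2.resolve_right (this _ hcc.sub))
        (hc'.2.resolve_right (this _ hcc'.sub))
    · exact hcc.eq_of_mem hcc' (hboth hsT hwT C hC).1 (hboth hsT hwT C' hC').1
  have hsub : suns H (insert s (insert w D) \ T) ⊆ suns H (D \ (T ∩ D)) ∪ Z := by
    intro C hC
    rw [mem_union]
    by_cases hCZ : C ∈ Z
    · exact .inr hCZ
    left
    have hn : ¬ (s ∈ C ∨ w ∈ C) := fun h => hCZ (mem_filter.2 ⟨hC, h⟩)
    push Not at hn
    rw [mem_suns] at hC ⊢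
    have hsb : D \ (T ∩ D) ⊆ insert s (insert w D) \ T := by
      intro x hx
      simp only [mem_sdiff, mem_inter, not_and] at hx
      simp only [mem_sdiff, mem_insert, hx.1, or_true, true_and]
      exact fun h => hx.2 h hx.1
    refine ⟨hC.1.anti hsb fun x hx => ?_, hC.2⟩
    have := hC.1.sub hx
    simp only [mem_sdiff, mem_insert] at this
    simp only [mem_sdiff, mem_inter, not_and]
    rcases this with ⟨rfl | rfl | h, hxT⟩
    · exact absurd hx hn.1
    · exact absurd hx hn.2
    · exact ⟨h, fun h => absurd h hxT⟩
  have hc1 := (card_le_card hsub).trans (card_union_le _ _)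
  have hc2 : (suns H (D \ (T ∩ D))).card ≤ 2 * (T ∩ D).card := by
    by_cases hne : (T ∩ D).Nonempty
    · have := hD (T ∩ D) inter_subset_right hne
      omega
    · rw [not_nonempty_iff_eq_empty] at hne
      simp [hne, hD0]
  by_cases hTD : T ⊆ D
  · have hTe : T ∩ D = T := inter_eq_left.2 hTD
    rw [hTe] at hc1 hc2
    by_cases hne : T.Nonempty
    · have := hD T hTD hne
      omega
    · rw [not_nonempty_iff_eq_empty] at hne
      subst hne
      have : Z = ∅ := by
        rw [eq_empty_iff_forall_notMem]
        intro C hC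
        obtain ⟨hsC, hwC⟩ := hboth (by simp) (by simp) C hC
        have hC' := mem_suns.1 (mem_filter.1 hC).1
        have hvC := hC'.1.closed s hsC v (by simp [hv]) hsv
        have hCX : ∀ y ∈ C, y ∈ insert s (insert w D) := fun y hy => by
          simpa using hC'.1.sub hy
        exact hC'.2.false_of_pendant hsC hwC hvC (by rintro rfl; exact hw hv) hsw hsv
          (fun y hy => hs1 y (hCX y hy)) fun y hy => hw1 y (hCX y hy)
      simp only [sdiff_empty, hD0, this, card_empty] at hc1 ⊢
      simpa using hc1
  · have : (T ∩ D).card < T.card := by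
      refine card_lt_card ⟨inter_subset_left, fun h => hTD (h.trans inter_subset_right)⟩
    omega

namespace MinCex

theorem not_leaf {s w r : V} (h : MinCex H A) (hs : s ∈ A) (hw : Leaf H A s w) :
    ¬ Leaf H A r s := by
  intro hr
  have hwr := hr.uniq w hw.mem hw.adj
  have : ({s, w} : Finset V) = A := by
    refine h.conn.min _ (by simp [insert_subset_iff, hs, hw.mem]) (by simp) fun x hx y hy hxy => ?_
    simp only [mem_insert, mem_singleton] at hx ⊢
    rcases hx with rfl | rfl
    · exact .inr ((hr.uniq y hy hxy).trans hwr.symm)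
    · exact .inl (hw.uniq y hy hxy)
  exact h.not_sun (this ▸ sun_pair hw.adj)

theorem leaf_unique {s w w' : V} (h : MinCex H A) (hs : s ∈ A) (hw : Leaf H A s w)
    (hw' : Leaf H A s w') : w = w' := by
  have h1 := h.strict (S := {s}) (by simpa using hs) (by simp)
  have h2 := hw.mem_suns (S := {s}) (by simp) (by simpa using hw.adj.ne')
  have h3 := hw'.mem_suns (S := {s}) (by simp) (by simpa using hw'.adj.ne')
  have := card_le_one.1 (show (suns H (A \ {s})).card ≤ 1 by rw [card_singleton] at h1; omega)
    _ h2 _ h3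
  simpa using this

/-- If `S` is a largest set of slack one then all components of `A \ S` are suns. -/
theorem biUnion_suns_eq (h : MinCex H A) (hS : S ⊆ A)
    (hsl : (suns H (A \ S)).card + 1 = 2 * S.card)
    (hmax : ∀ T ⊆ A \ S, T.Nonempty → (suns H (A \ (S ∪ T))).card + 2 ≤ 2 * (S ∪ T).card) :
    (suns H (A \ S)).biUnion id = A \ S := by
  by_contra hneq
  have hsubW : (suns H (A \ S)).biUnion id ⊆ A \ S :=
    biUnion_subset.2 fun C hC => (mem_suns.1 hC).1.sub
  obtain ⟨x, hx, hxW⟩ : ∃ x ∈ A \ S, x ∉ (suns H (A \ S)).biUnion id := by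
    by_contra! hn
    exact hneq (subset_antisymm hsubW hn)
  have hne : S.Nonempty := by
    rw [nonempty_iff_ne_empty]; rintro rfl; simp at hsl
  obtain ⟨D, hDc, hxD⟩ := exists_comp (H := H) hx
  have hDs : D ∉ suns H (A \ S) := fun hD => hxW (mem_biUnion.2 ⟨D, hD, hxD⟩)
  have hDdj : ∀ C ∈ suns H (A \ S), Disjoint C D := fun C hC =>
    (mem_suns.1 hC).1.disjoint hDc (by rintro rfl; exact hDs hC)
  have hDA : D ⊆ A := hDc.sub.trans sdiff_subset
  have hDS : ∀ d ∈ D, d ∉ S := fun d hd => (mem_sdiff.1 (hDc.sub hd)).2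
  have hDT : ∀ T ⊆ D, T.Nonempty → (suns H (D \ T)).card + 1 ≤ 2 * T.card := by
    intro T hT hTne
    have h1 := card_suns_add_le subset_rfl hDc.sub hDc.closed hDdj hT
    have h2 := hmax T (hT.trans hDc.sub) hTne
    have h3 := card_union_le S T
    omega
  have hD0 : suns H D = ∅ := by
    rw [eq_empty_iff_forall_notMem]
    intro C hC
    rw [mem_suns] at hC
    have := hDc.min C hC.1.sub hC.1.ne hC.1.closed
    exact hDs (mem_suns.2 ⟨hDc, this ▸ hC.2⟩)
  obtain ⟨s₀, hs₀, v, hv, hsv⟩ : ∃ s ∈ S, ∃ v ∈ D, H.Adj s v := by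
    by_contra! hn
    have := h.conn.min D hDA hDc.ne fun a ha b hb hab => hDc.closed a ha b (mem_sdiff.2
      ⟨hb, fun hbS => hn b hbS a ha hab.symm⟩) hab
    obtain ⟨s, hs⟩ := hne
    exact hDS s (this ▸ hS hs) hs
  obtain ⟨w, hw⟩ := h.exists_leaf hS hsl hs₀
  have hwS : w ∉ S := fun hwS => by
    obtain ⟨w', hw'⟩ := h.exists_leaf hS hsl hwS
    exact h.not_leaf hw.mem hw' hw
  have hwsun := hw.mem_suns hs₀ hwS
  have hwD : w ∉ D := disjoint_singleton_left.1 (hDdj _ hwsun)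
  have hsD : s₀ ∉ D := fun hd => hDS _ hd hs₀
  set E := H.deleteEdges {e | ∃ d ∈ D, d ≠ v ∧ e = s(s₀, d)} with hE
  have hEle : E ≤ H := SimpleGraph.deleteEdges_le _
  have hEadj : ∀ a b, E.Adj a b ↔ H.Adj a b ∧ ¬ ∃ d ∈ D, d ≠ v ∧ s(a, b) = s(s₀, d) :=
    fun a b => by simp [hE, SimpleGraph.deleteEdges_adj]
  have hED : ∀ a ∈ D, ∀ b ∈ D, H.Adj a b ↔ E.Adj a b := by
    intro a ha b hb
    rw [hEadj]
    refine ⟨fun hab => ⟨hab, fun ⟨d, _, _, he⟩ => ?_⟩, And.left⟩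
    have : s₀ ∈ s(a, b) := by rw [he]; simp
    rcases Sym2.mem_iff.1 this with rfl | rfl
    · exact hsD ha
    · exact hsD hb
  have hAA : insert s₀ (insert w D) ⊆ A := by
    simp [insert_subset_iff, hS hs₀, hw.mem, hDA]
  have hkan : Kan E (insert s₀ (insert w D)) := by
    refine kan_pendant (fun T hT hTne => ?_) ?_ hv hsD hwD ?_ ?_ ?_ ?_
    · rw [← suns_congr (H := H)]
      · exact hDT T hT hTne
      · exact fun a ha b hb => hED a (mem_sdiff.1 ha).1 b (mem_sdiff.1 hb).1
    · rw [← suns_congr hED, hD0]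
    · rw [hEadj]
      refine ⟨hw.adj, fun ⟨d, hd, _, he⟩ => hwD ?_⟩
      have : d = w := by
        have : w ∈ s(s₀, d) := by rw [← he]; simp
        rcases Sym2.mem_iff.1 this with h1 | h1
        · exact absurd h1 hw.adj.ne'
        · exact h1.symm
      exact this ▸ hd
    · rw [hEadj]
      refine ⟨hsv, fun ⟨d, hd, hdv, he⟩ => hdv ?_⟩
      have : v ∈ s(s₀, d) := by rw [← he]; simp
      rcases Sym2.mem_iff.1 this with h1 | h1
      · exact absurd h1 hsv.ne'
      · exact h1.symm
    · intro d hd hsd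
      by_contra hdv
      exact ((hEadj _ _).1 hsd).2 ⟨d, hd, hdv, rfl⟩
    · intro d hd hwd
      have := hw.uniq d (hDA hd) (hEle hwd)
      exact hsD (this ▸ hd)
  have hproper : insert s₀ (insert w D) ≠ A ∨ E ≠ H := by
    by_contra! hn
    obtain ⟨hA, hEH⟩ := hn
    have hvA := hDA hv
    have hcl : Closed H (A \ {v}) {s₀, w} := by
      intro a ha b hb hab
      simp only [mem_insert, mem_singleton] at ha ⊢
      rw [mem_sdiff, mem_singleton] at hb
      rcases ha with rfl | rfl
      · have hb1 := hb.1
        rw [← hA] at hb1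
        simp only [mem_insert] at hb1
        rcases hb1 with h1 | h1 | h1
        · exact .inl h1
        · exact .inr h1
        · rw [← hEH, hEadj] at hab
          exact absurd ⟨b, h1, hb.2, rfl⟩ hab.2
      · exact .inl (hw.uniq b hb.1 hab)
    have hmem : {s₀, w} ∈ suns H (A \ {v}) := mem_suns.2 ⟨comp_pair hw.adj
      (mem_sdiff.2 ⟨hS hs₀, by simpa using hsv.ne⟩)
      (mem_sdiff.2 ⟨hw.mem, by rw [mem_singleton]; rintro rfl; exact hwD hv⟩) hcl, sun_pair hw.adj⟩
    have h1 := h.strict (S := {v}) (by simpa using hvA) (by simp)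
    have h2 := card_pos.2 ⟨_, hmem⟩
    rw [card_singleton] at h1
    obtain ⟨l, hl⟩ := h.exists_leaf (S := {v}) (by simpa using hvA)
      (by rw [card_singleton]; omega) (mem_singleton_self v)
    have h3 := hl.mem_suns (S := {v}) (by simp) (by simpa using hl.adj.ne')
    have h4 := card_le_one.1 (by omega) _ hmem _ h3
    have h5 := congrArg card h4
    rw [card_pair hw.adj.ne, card_singleton] at h5
    omega
  have ht1 := (h.ih E _ hEle hAA hproper hkan).mono hEle
  obtain ⟨g, hg, hg2⟩ := h.exists_assignment_erase hS hsl hs₀ hwsun fun K hK hsK => by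
    have h1 : insert {w} K ⊆ suns H (A \ S) :=
      insert_subset hwsun (hK.trans (erase_subset _ _))
    have hU := biUnion_nbr_subset (H := H) (S := S) (K := K)
    have h2 := card_le_card_suns h1 hU fun C hC => by
      rcases mem_insert.1 hC with rfl | hC
      · intro s hs
        rw [mem_nbr] at hs
        obtain ⟨hsS, c, hc, hsc⟩ := hs
        rw [mem_singleton] at hc
        subst hc
        rwa [hw.uniq s (hS hsS) hsc.symm]
      · exact subset_biUnion_of_mem (nbr H S) hC
    rw [card_insert_of_notMem fun hwK => (mem_erase.1 (hK hwK)).1 rfl] at h2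
    have h3 := h.strict (hU.trans hS) ⟨s₀, hsK⟩
    omega
  have ht2 : Tiled H (S.erase s₀ ∪ ((suns H (A \ S)).erase {w}).biUnion id) :=
    tiled_stars (erase_subset _ _) (disjoint_sdiff.mono_left (erase_subset s₀ S))
      (fun C hC => nbr_subset (hg C hC))
      (fun C hC => (mem_nbr.1 (hg C hC)).2) hg2
  set Y := suns H (A \ S) with hY
  have hclW : Closed H (A \ S) (((A \ S) \ Y.biUnion id) \ D) := by
    intro a ha b hb hab
    rw [mem_sdiff] at ha ⊢
    refine ⟨closed_sdiff_biUnion (fun C hC => (mem_suns.1 hC).1.closed) a ha.1 b hb hab,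
      fun hbD => ha.2 (hDc.closed b hbD a (mem_sdiff.1 ha.1).1 hab.symm)⟩
  have ht3 : Tiled H (((A \ S) \ Y.biUnion id) \ D) := by
    refine h.tiled_of_closed hS hne (sdiff_subset.trans sdiff_subset) hclW
      (fun C hC => (disjoint_rest C hC).mono_right sdiff_subset) fun T hT => ?_
    have h1 := h.strict (union_subset hS (hT.trans (sdiff_subset.trans (sdiff_subset.trans
      sdiff_subset)))) (hne.mono subset_union_left)
    have h2 := card_union_le S T
    rw [← hY]
    omega
  have hwY : ∀ C ∈ Y.erase {w}, w ∉ C := fun C hC hwC => (mem_erase.1 hC).1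
    ((mem_suns.1 (mem_of_mem_erase hC)).1.eq_of_mem (mem_suns.1 hwsun).1 hwC (by simp))
  have hYS : ∀ C ∈ Y, ∀ c ∈ C, c ∉ S := fun C hC c hc =>
    (mem_sdiff.1 ((mem_suns.1 hC).1.sub hc)).2
  refine h.not_tiled ?_
  have hfin := (ht1.union ht2 ?_).union ht3 ?_
  · convert hfin using 1
    ext a
    simp only [mem_union, mem_insert, mem_erase, mem_biUnion, mem_sdiff, id]
    constructor
    · intro ha
      by_cases haD : a ∈ D
      · simp [haD]
      by_cases haS : a ∈ S
      · by_cases has : a = s₀ <;> simp [has, haS]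
      by_cases haw : a = w
      · simp [haw]
      by_cases haY : ∃ C ∈ Y, a ∈ C
      · obtain ⟨C, hC, haC⟩ := haY
        refine .inl (.inr (.inr ⟨C, ⟨?_, hC⟩, haC⟩))
        rintro rfl
        exact haw (mem_singleton.1 haC)
      · exact .inr ⟨⟨⟨ha, haS⟩, haY⟩, haD⟩
    · rintro (((rfl | rfl | ha) | ha | ⟨C, hC, ha⟩) | ha)
      · exact hS hs₀
      · exact hw.mem
      · exact hDA ha
      · exact hS ha.2
      · exact (mem_sdiff.1 ((mem_suns.1 hC.2).1.sub ha)).1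
      · exact ha.1.1.1
  · rw [disjoint_left]
    intro a ha ha'
    simp only [mem_union, mem_insert, mem_erase, mem_biUnion, id] at ha ha'
    rcases ha' with ha' | ⟨C, hC, haC⟩
    · rcases ha with rfl | rfl | ha
      · exact ha'.1 rfl
      · exact hwS ha'.2
      · exact hDS a ha ha'.2
    · rcases ha with rfl | rfl | ha
      · exact hYS C hC.2 _ haC hs₀
      · exact hwY C (mem_erase.2 hC) haC
      · exact disjoint_left.1 (hDdj C hC.2) haC ha
  · rw [disjoint_left]
    intro a ha ha'
    simp only [mem_union, mem_insert, mem_erase, mem_biUnion, mem_sdiff, id] at ha ha'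
    obtain ⟨⟨⟨haA, haS⟩, haY⟩, haD⟩ := ha'
    rcases ha with (rfl | rfl | ha) | ha | ⟨C, hC, haC⟩
    · exact haS hs₀
    · exact haY ⟨_, hwsun, by simp⟩
    · exact haD ha
    · exact haS ha.2
    · exact haY ⟨C, hC.2, haC⟩

end MinCex

end

section

variable {H H' : SimpleGraph V} {X A B C D R S T U : Finset V} {p : V → V}
variable {Y : Finset (Finset V)}

/-- Two core vertices of a corona can be completed to three, one of the new adjacencies being
prescribed, so that the remaining vertices are tiled. -/
theorem Corona.exists_third (h : Corona H C R p) {u u' : V} (hu : u ∈ R) (hu' : u' ∈ R)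
    (hne : u ≠ u') : ∃ z ∈ R, z ≠ u ∧ z ≠ u' ∧ H.Adj u z ∧
      Tiled H (C \ {u, z, u', p u, p z, p u'}) := by
  obtain ⟨z, hz, huz, hB⟩ := (h.fc.2 u' hu').exists_pair (mem_erase.2 ⟨hne, hu⟩)
  rw [mem_erase] at hz
  refine ⟨z, hz.2, huz.ne', hz.1, huz, ?_⟩
  have hK : ({u, z, u'} : Finset V) ⊆ R := by simp [insert_subset_iff, hu, hu', hz.2]
  have h1 := h.sdiff_image_eq hK
  have h2 : R \ {u, z, u'} = ((R.erase u').erase u).erase z := by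
    ext a
    simp only [mem_sdiff, mem_insert, mem_singleton, mem_erase]
    tauto
  have h3 := h.tiled_of_PM hB fun a ha => by
    simp only [mem_erase] at ha
    exact ha.2.2.2
  rw [h2] at h1
  rw [← h1] at h3
  convert h3 using 2
  ext a
  simp only [mem_union, mem_image, mem_insert, mem_singleton]
  grind

section Split

variable {s₁ w₁ s₂ w₂ u : V}

/-- The pendant of `u` and `u` itself are attached to different outer edges. -/
theorem Corona.tiled_split_core (h : Corona H C R p) (hu : u ∈ R)
    (h₁ : H.Adj s₁ w₁) (h₂ : H.Adj s₂ w₂) (hs₁ : s₁ ∉ C) (hw₁ : w₁ ∉ C)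
    (hs₂ : s₂ ∉ C) (hw₂ : w₂ ∉ C) (hss : s₁ ≠ s₂) (hww : w₁ ≠ w₂) (hsw : s₁ ≠ w₂)
    (hws : w₁ ≠ s₂) (hp : H.Adj s₁ (p u)) (hu₂ : H.Adj s₂ u) :
    Tiled H ({s₁, w₁, s₂, w₂} ∪ C) := by
  have huC := h.core_mem hu
  have hpC := h.pendant_mem hu
  have t1 : Tiled H {w₁, s₁, p u} := tiled_three h₁.symm hp (by rintro rfl; exact hw₁ hpC)
  have t2 : Tiled H {u, s₂, w₂} := tiled_three hu₂.symm h₂ (by rintro rfl; exact hw₂ huC)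
  have hne := (h.adj u hu).ne
  have t3 := h.tiled_sdiff_pair hu
  refine t1.of_sdiff ?_ (t2.of_sdiff ?_ ?_)
  · grind
  · grind
  · convert t3 using 1
    ext a
    grind

/-- The pendant of `u` is attached to two outer edges. -/
theorem Corona.tiled_split_pendant (h : Corona H C R p) (hu : u ∈ R) {u' : V} (hu' : u' ∈ R)
    (huu : u ≠ u') (h₁ : H.Adj s₁ w₁) (h₂ : H.Adj s₂ w₂) (hs₁ : s₁ ∉ C) (hw₁ : w₁ ∉ C)
    (hs₂ : s₂ ∉ C) (hw₂ : w₂ ∉ C) (hss : s₁ ≠ s₂) (hww : w₁ ≠ w₂) (hsw : s₁ ≠ w₂)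
    (hws : w₁ ≠ s₂) (hp : H.Adj s₁ (p u)) (hp₂ : H.Adj s₂ (p u)) :
    Tiled H ({s₁, w₁, s₂, w₂} ∪ C) := by
  obtain ⟨v, hv, -, huv⟩ := h.fc.exists_adj hu hu' huu
  obtain ⟨z, hz, hzu, hzv, huz, t3⟩ := h.exists_third hu hv huv.ne
  have hpC := h.pendant_mem hu
  have hinj : ∀ a ∈ R, ∀ b ∈ R, a ≠ b → p a ≠ p b := fun a ha b hb hab e =>
    hab (h.inj ha hb e)
  have hne : ∀ a ∈ R, ∀ b ∈ R, a ≠ p b := fun a ha b hb e => h.notMem b hb (e ▸ ha)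
  have t1 : Tiled H {w₁, s₁, p u, s₂, w₂} := tiled_five h₁.symm hp hp₂.symm h₂
    (by rintro rfl; exact hw₁ hpC) hws hww hss hsw (by rintro rfl; exact hw₂ hpC)
  have t2 : Tiled H {p v, v, u, z, p z} := tiled_five (h.adj v hv).symm huv.symm huz
    (h.adj z hz) (hne u hu v hv).symm (hne z hz v hv).symm (hinj v hv z hz hzv.symm) hzv.symm
    (hne v hv z hz) (hne u hu z hz)
  have m1 := h.core_mem hu
  have m2 := h.core_mem hv
  have m3 := h.core_mem hz
  have m4 := h.pendant_mem hv
  have m5 := h.pendant_mem hz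
  have e1 := hinj u hu v hv huv.ne
  have e2 := hinj u hu z hz hzu.symm
  have e3 := hne u hu u hu
  have e4 := hne v hv u hu
  have e5 := hne z hz u hu
  refine t1.of_sdiff ?_ (t2.of_sdiff ?_ ?_)
  · grind
  · intro a ha
    simp only [mem_insert, mem_singleton] at ha
    simp only [mem_sdiff, mem_union, mem_insert, mem_singleton]
    rcases ha with rfl | rfl | rfl | rfl | rfl <;> grind
  · convert t3 using 1
    ext a
    simp only [mem_sdiff, mem_union, mem_insert, mem_singleton]
    grind

/-- The pendant of `u` and a vertex that belongs to another core vertex are attached to different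
outer edges. -/
theorem Corona.tiled_split_other (h : Corona H C R p) (hu : u ∈ R) {u' v v' : V} (hu' : u' ∈ R)
    (huu : u ≠ u') (h₁ : H.Adj s₁ w₁) (h₂ : H.Adj s₂ w₂) (hs₁ : s₁ ∉ C) (hw₁ : w₁ ∉ C)
    (hs₂ : s₂ ∉ C) (hw₂ : w₂ ∉ C) (hss : s₁ ≠ s₂) (hww : w₁ ≠ w₂) (hsw : s₁ ≠ w₂)
    (hws : w₁ ≠ s₂) (hp : H.Adj s₁ (p u)) (hv₂ : H.Adj s₂ v)
    (hvv : v = u' ∧ v' = p u' ∨ v = p u' ∧ v' = u') :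
    Tiled H ({s₁, w₁, s₂, w₂} ∪ C) := by
  obtain ⟨z, hz, hzu, hzv, huz, t3⟩ := h.exists_third hu hu' huu
  have hpC := h.pendant_mem hu
  have hinj : ∀ a ∈ R, ∀ b ∈ R, a ≠ b → p a ≠ p b := fun a ha b hb hab e =>
    hab (h.inj ha hb e)
  have hne : ∀ a ∈ R, ∀ b ∈ R, a ≠ p b := fun a ha b hb e => h.notMem b hb (e ▸ ha)
  have hadj : H.Adj v v' := by
    rcases hvv with ⟨rfl, rfl⟩ | ⟨rfl, rfl⟩
    · exact h.adj _ hu'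
    · exact (h.adj _ hu').symm
  have m1 := h.core_mem hu
  have m2 := h.core_mem hu'
  have m3 := h.core_mem hz
  have m4 := h.pendant_mem hu'
  have m5 := h.pendant_mem hz
  have mv : v ∈ C := by rcases hvv with ⟨rfl, rfl⟩ | ⟨rfl, rfl⟩ <;> assumption
  have mv' : v' ∈ C := by rcases hvv with ⟨rfl, rfl⟩ | ⟨rfl, rfl⟩ <;> assumption
  have t1 : Tiled H {w₁, s₁, p u} := tiled_three h₁.symm hp (by rintro rfl; exact hw₁ hpC)
  have t2 : Tiled H {w₂, s₂, v, v'} := tiled_four h₂.symm hv₂ hadj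
    (by rintro rfl; exact hw₂ mv) (by rintro rfl; exact hw₂ mv') (by rintro rfl; exact hs₂ mv')
  have t4 : Tiled H {p z, z, u} := tiled_three (h.adj z hz).symm huz.symm (hne u hu z hz).symm
  have e1 := hinj u hu u' hu' huu
  have e2 := hinj u hu z hz hzu.symm
  have e3 := hne u hu u hu
  have e4 := hne u' hu' u hu
  have e5 := hne z hz u hu
  have e6 := hne u hu u' hu'
  have e7 := hne z hz u' hu'
  have e8 := hne u' hu' z hz
  have e9 := hinj u' hu' z hz hzv.symm
  have hset : ({w₂, s₂, v, v'} : Finset V) = {w₂, s₂, u', p u'} := by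
    rcases hvv with ⟨rfl, rfl⟩ | ⟨rfl, rfl⟩
    · rfl
    · rw [pair_comm]
  rw [hset] at t2
  refine t1.of_sdiff ?_ (t2.of_sdiff ?_ (t4.of_sdiff ?_ ?_))
  · grind
  · intro a ha
    simp only [mem_insert, mem_singleton] at ha
    simp only [mem_sdiff, mem_union, mem_insert, mem_singleton]
    rcases ha with rfl | rfl | rfl | rfl <;> grind
  · intro a ha
    simp only [mem_insert, mem_singleton] at ha
    simp only [mem_sdiff, mem_union, mem_insert, mem_singleton]
    rcases ha with rfl | rfl | rfl <;> grind
  · convert t3 using 1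
    ext a
    simp only [mem_sdiff, mem_union, mem_insert, mem_singleton]
    grind

end Split

end

section

variable {H H' : SimpleGraph V} {X A B C D R S T U : Finset V} {p : V → V}
variable {Y : Finset (Finset V)}

variable {w : V → V}

/-- `S` has slack one, `A \ S` consists of suns, and every `s ∈ S` has the leaf `w s`. -/
structure Full (H : SimpleGraph V) (A S : Finset V) (w : V → V) : Prop where
  sub : S ⊆ A
  slack : (suns H (A \ S)).card + 1 = 2 * S.card
  cover : (suns H (A \ S)).biUnion id = A \ S
  leaf : ∀ s ∈ S, Leaf H A s (w s)
  notMem : ∀ s ∈ S, w s ∉ S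

theorem MinCex.exists_full (h : MinCex H A) {x : V} (hS : S ⊆ A)
    (hsl : (suns H (A \ S)).card + 1 = 2 * S.card) (hx : x ∈ S) :
    ∃ S w, x ∈ S ∧ Full H A S w := by
  obtain ⟨S', hS', hmax⟩ := exists_max_image (A.powerset.filter fun S =>
    x ∈ S ∧ (suns H (A \ S)).card + 1 = 2 * S.card) card ⟨S, by simp [hS, hx, hsl]⟩
  simp only [mem_filter, mem_powerset] at hS' hmax
  obtain ⟨hSA, hxS, hsl'⟩ := hS'
  have hlf : ∀ s, ∃ w, s ∈ S' → Leaf H A s w := fun s => by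
    by_cases hs : s ∈ S'
    · obtain ⟨w, hw⟩ := h.exists_leaf hSA hsl' hs
      exact ⟨w, fun _ => hw⟩
    · exact ⟨s, fun h => absurd h hs⟩
  choose w hw using hlf
  refine ⟨S', w, hxS, hSA, hsl', h.biUnion_suns_eq hSA hsl' fun T hT hne => ?_, hw,
    fun s hs hws => ?_⟩
  · have h1 := h.strict (union_subset hSA (hT.trans sdiff_subset)) (hne.mono subset_union_right)
    by_contra hlt
    have h2 := hmax (S' ∪ T) ⟨union_subset hSA (hT.trans sdiff_subset), mem_union_left _ hxS,
      by omega⟩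
    rw [card_union_of_disjoint (disjoint_sdiff.mono_right hT)] at h2
    have := hne.card_pos
    omega
  · exact h.not_leaf (hSA hws) (hw _ hws) (hw s hs)

namespace Full

/-- The sun components of `A \ S` other than the leaves. -/
noncomputable def big (H : SimpleGraph V) (A S : Finset V) (w : V → V) : Finset (Finset V) :=
  suns H (A \ S) \ S.image fun s => {w s}

theorem leaf_mem (hF : Full H A S w) {s : V} (hs : s ∈ S) : {w s} ∈ suns H (A \ S) :=
  (hF.leaf s hs).mem_suns hs (hF.notMem s hs)

theorem leaf_inj (hF : Full H A S w) {s t : V} (hs : s ∈ S) (ht : t ∈ S) (h : w s = w t) :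
    s = t :=
  (hF.leaf t ht).uniq s (hF.sub hs) (h ▸ (hF.leaf s hs).adj.symm)

theorem mem_suns_of_big (hC : C ∈ big H A S w) : C ∈ suns H (A \ S) := (mem_sdiff.1 hC).1

theorem leaf_notMem (hF : Full H A S w) (hC : C ∈ big H A S w) {s : V} (hs : s ∈ S) :
    w s ∉ C := by
  intro h
  refine (mem_sdiff.1 hC).2 (mem_image.2 ⟨s, hs, ?_⟩)
  exact (mem_suns.1 (hF.leaf_mem hs)).1.eq_of_mem (mem_suns.1 (mem_suns_of_big hC)).1 (by simp) h

theorem notMem_big (hC : C ∈ big H A S w) {s : V} (hs : s ∈ S) : s ∉ C := fun h =>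
  (mem_sdiff.1 ((mem_suns.1 (mem_suns_of_big hC)).1.sub h)).2 hs

theorem card_image_leaf (hF : Full H A S w) (hU : U ⊆ S) :
    (U.image fun s => ({w s} : Finset V)).card = U.card :=
  card_image_of_injOn fun s hs t ht h => hF.leaf_inj (hU hs) (hU ht) (by simpa using h)

theorem image_leaf_subset (hF : Full H A S w) (hU : U ⊆ S) :
    (U.image fun s => ({w s} : Finset V)) ⊆ suns H (A \ S) := by
  intro C hC
  obtain ⟨s, hs, rfl⟩ := mem_image.1 hC
  exact hF.leaf_mem (hU hs)

theorem card_big (hF : Full H A S w) : (big H A S w).card + 1 = S.card := by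
  have h1 := hF.slack
  have h2 := card_sdiff_add_card_eq_card (hF.image_leaf_subset subset_rfl)
  rw [hF.card_image_leaf subset_rfl] at h2
  rw [big]
  omega

theorem card_add_one_le (hF : Full H A S w) (h : MinCex H A) {K : Finset (Finset V)}
    (hK : K ⊆ big H A S w) (hne : (K.biUnion (nbr H S)).Nonempty) :
    K.card + 1 ≤ (K.biUnion (nbr H S)).card := by
  set U := K.biUnion (nbr H S) with hU
  have hUS : U ⊆ S := MinCex.biUnion_nbr_subset
  have h1 : K ∪ (U.image fun s => ({w s} : Finset V)) ⊆ suns H (A \ S) :=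
    union_subset (fun C hC => mem_suns_of_big (hK hC)) (hF.image_leaf_subset hUS)
  have h2 := card_le_card_suns h1 hUS fun C hC => by
    rcases mem_union.1 hC with hC | hC
    · exact subset_biUnion_of_mem (nbr H S) hC
    · obtain ⟨s, hs, rfl⟩ := mem_image.1 hC
      intro t ht
      obtain ⟨htS, c, hc, htc⟩ := mem_nbr.1 ht
      rw [mem_singleton] at hc
      subst hc
      rwa [(hF.leaf s (hUS hs)).uniq t (hF.sub htS) htc.symm]
  rw [card_union_of_disjoint, hF.card_image_leaf hUS] at h2
  · have h3 := h.strict (hUS.trans hF.sub) hne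
    omega
  · rw [disjoint_left]
    intro C hC hC'
    exact (mem_sdiff.1 (hK hC)).2 (image_subset_image hUS hC')

theorem nonempty (hF : Full H A S w) : S.Nonempty := by
  rw [← card_pos]
  have := hF.slack
  omega

theorem nbr_nonempty (hF : Full H A S w) (h : MinCex H A) (hC : C ∈ big H A S w) :
    (nbr H S C).Nonempty := by
  by_contra hn
  rw [not_nonempty_iff_eq_empty, eq_empty_iff_forall_notMem] at hn
  have hc := (mem_suns.1 (mem_suns_of_big hC)).1
  have := h.conn.min C (hc.sub.trans sdiff_subset) hc.ne fun a ha b hb hab =>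
    hc.closed a ha b (mem_sdiff.2 ⟨hb, fun hbS => hn b (mem_nbr.2 ⟨hbS, a, ha, hab.symm⟩)⟩) hab
  obtain ⟨s, hs⟩ := hF.nonempty
  exact notMem_big hC hs (this ▸ hF.sub hs)

theorem card_add_one_le' (hF : Full H A S w) (h : MinCex H A) {K : Finset (Finset V)}
    (hK : K ⊆ big H A S w) (hne : K.Nonempty) : K.card + 1 ≤ (K.biUnion (nbr H S)).card := by
  obtain ⟨C, hC⟩ := hne
  obtain ⟨s, hs⟩ := hF.nbr_nonempty h (hK hC)
  exact hF.card_add_one_le h hK ⟨s, mem_biUnion.2 ⟨C, hC, hs⟩⟩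

theorem mem_cases (hF : Full H A S w) {a : V} (ha : a ∈ A) :
    a ∈ S ∨ (∃ s ∈ S, a = w s) ∨ ∃ C ∈ big H A S w, a ∈ C := by
  by_cases haS : a ∈ S
  · exact .inl haS
  right
  have : a ∈ (suns H (A \ S)).biUnion id := by
    rw [hF.cover]
    exact mem_sdiff.2 ⟨ha, haS⟩
  obtain ⟨C, hC, haC⟩ := mem_biUnion.1 this
  by_cases hC' : C ∈ S.image fun s => ({w s} : Finset V)
  · obtain ⟨s, hs, rfl⟩ := mem_image.1 hC'
    exact .inl ⟨s, hs, by simpa using haC⟩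
  · exact .inr ⟨C, mem_sdiff.2 ⟨hC, hC'⟩, haC⟩

theorem big_disjoint (hC : C ∈ big H A S w) (hD : D ∈ big H A S w) (hne : C ≠ D) : Disjoint C D :=
  (mem_suns.1 (mem_suns_of_big hC)).1.disjoint (mem_suns.1 (mem_suns_of_big hD)).1 hne

/-- Assign the large suns to different elements of `S`, where `C` is assigned to two of them. -/
theorem exists_split (hF : Full H A S w) (h : MinCex H A) (hC : C ∈ big H A S w) {N₁ N₂ : Finset V}
    (hN₁ : N₁.Nonempty) (hN₂ : N₂.Nonempty) (hN : N₁ ∪ N₂ = nbr H S C) :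
    ∃ s₁ ∈ N₁, ∃ s₂ ∈ N₂, s₁ ≠ s₂ ∧ ∃ g : Finset V → V,
      (∀ D ∈ (big H A S w).erase C, g D ∈ nbr H S D ∧ g D ≠ s₁ ∧ g D ≠ s₂) ∧
      Set.InjOn g ((big H A S w).erase C) ∧
      ∀ s ∈ S, s = s₁ ∨ s = s₂ ∨ ∃ D ∈ (big H A S w).erase C, g D = s := by
  have : Nonempty V := ⟨hN₁.choose⟩
  set Y := big H A S w with hY
  let N : Option (Finset V) → Finset V := fun o =>
    o.elim N₁ fun D => if D = C then N₂ else nbr H S D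
  have hNC : N (some C) = N₂ := by simp [N]
  have hNn : N none = N₁ := rfl
  have hND : ∀ D, D ≠ C → N (some D) = nbr H S D := fun D hD => by simp [N, hD]
  have hN1 : N₁ ⊆ nbr H S C := hN ▸ subset_union_left
  have hN2 : N₂ ⊆ nbr H S C := hN ▸ subset_union_right
  obtain ⟨g, hg, hg1⟩ := exists_assignment 1 (insertNone Y) N S (fun o ho => by
      rcases o with _ | D
      · exact hN1.trans nbr_subset
      · by_cases hD : D = C
        · rw [hD, hNC]; exact hN2.trans nbr_subset
        · rw [hND D hD]; exact nbr_subset)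
    (by rw [card_insertNone, one_mul]; exact hF.card_big) (fun K hK => by
      rw [one_mul]
      have hK' : ∀ D, some D ∈ K → D ∈ Y := fun D hD => by simpa using hK hD
      by_cases hboth : none ∈ K ∧ some C ∈ K
      · have h1 : (eraseNone K).card + 1 = K.card := by
          rw [card_eraseNone_eq_card_erase, card_erase_add_one hboth.1]
        have h2 := hF.card_add_one_le' h (K := eraseNone K)
          (fun D hD => hK' D (mem_eraseNone.1 hD)) ⟨C, mem_eraseNone.2 hboth.2⟩
        rw [← h1]
        refine h2.trans (card_le_card ?_)
        intro s hs
        obtain ⟨D, hD, hsD⟩ := mem_biUnion.1 hs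
        by_cases hDC : D = C
        · subst hDC
          rw [← hN, mem_union] at hsD
          rcases hsD with hsD | hsD
          · exact mem_biUnion.2 ⟨none, hboth.1, hsD⟩
          · exact mem_biUnion.2 ⟨some D, hboth.2, by rwa [hNC]⟩
        · exact mem_biUnion.2 ⟨some D, mem_eraseNone.1 hD, by rwa [hND D hDC]⟩
      · set K' := (eraseNone K).erase C with hKK
        have hsubK : K ⊆ K'.image some ∪ (K.filter fun o => o = none ∨ o = some C) := by
          intro o ho
          rw [mem_union]
          by_cases hoo : o = none ∨ o = some C
          · exact .inr (mem_filter.2 ⟨ho, hoo⟩)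
          · push Not at hoo
            obtain ⟨D, rfl⟩ := Option.ne_none_iff_exists'.1 hoo.1
            refine .inl (mem_image_of_mem _ (mem_erase.2 ⟨fun e => hoo.2 (e ▸ rfl), ?_⟩))
            exact mem_eraseNone.2 ho
        have h1 : (K.filter fun o => o = none ∨ o = some C).card ≤ 1 := by
          refine card_le_one.2 fun a ha b hb => ?_
          rw [mem_filter] at ha hb
          rcases ha with ⟨ha, rfl | rfl⟩ <;> rcases hb with ⟨hb, rfl | rfl⟩
          · rfl
          · exact absurd ⟨ha, hb⟩ hboth
          · exact absurd ⟨hb, ha⟩ hboth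
          · rfl
        have h2 := (card_le_card hsubK).trans (card_union_le _ _)
        have h3 : (K'.image some).card ≤ K'.card := card_image_le
        by_cases hne : K'.Nonempty
        · have h4 := hF.card_add_one_le' h (K := K')
            (fun D hD => hK' D (mem_eraseNone.1 (mem_of_mem_erase hD))) hne
          have h5 : K'.biUnion (nbr H S) ⊆ K.biUnion N := fun s hs => by
            obtain ⟨D, hD, hsD⟩ := mem_biUnion.1 hs
            rw [mem_erase, mem_eraseNone] at hD
            exact mem_biUnion.2 ⟨some D, hD.2, by rwa [hND D hD.1]⟩
          have h6 := card_le_card h5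
          omega
        · rw [not_nonempty_iff_eq_empty] at hne
          rw [hne, image_empty, empty_union] at hsubK
          rcases K.eq_empty_or_nonempty with rfl | ⟨o, ho⟩
          · simp
          · have h4 := (card_le_card hsubK).trans h1
            have h5 : (N o).Nonempty := by
              rcases (mem_filter.1 (hsubK ho)).2 with rfl | rfl
              · exact hN₁
              · rwa [hNC]
            have h6 := h5.card_pos
            have h7 := card_le_card (subset_biUnion_of_mem N ho)
            omega)
  have hinj : ∀ a ∈ insertNone Y, ∀ b ∈ insertNone Y, g a = g b → a = b := by
    intro a ha b hb hab
    have hgS : g b ∈ S := by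
      have := hg b hb
      rcases b with _ | D
      · exact nbr_subset (hN1 this)
      · by_cases hD : D = C
        · rw [hD, hNC] at this; rw [hD]; exact nbr_subset (hN2 this)
        · rw [hND D hD] at this; exact nbr_subset this
    exact card_le_one.1 (hg1 _ hgS).le a (mem_filter.2 ⟨ha, hab⟩) b (mem_filter.2 ⟨hb, rfl⟩)
  have hsome : ∀ D ∈ Y, some D ∈ insertNone Y := fun D hD => by simpa using hD
  refine ⟨g none, hg none (by simp), g (some C), hNC ▸ hg _ (hsome C hC), fun e => ?_,
    fun D => g (some D), fun D hD => ?_, fun D hD D' hD' e => ?_, fun s hs => ?_⟩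
  · simpa using hinj _ (by simp) _ (hsome C hC) e
  · rw [mem_erase] at hD
    refine ⟨hND D hD.1 ▸ hg _ (hsome D hD.2), fun e => ?_, fun e => hD.1 ?_⟩
    · simpa using hinj _ (hsome D hD.2) _ (by simp) e
    · simpa using hinj _ (hsome D hD.2) _ (hsome C hC) e
  · simpa using hinj _ (hsome D (mem_of_mem_erase hD)) _ (hsome D' (mem_of_mem_erase hD')) e
  · obtain ⟨o, ho⟩ := card_eq_one.1 (hg1 s hs)
    have hom : o ∈ (insertNone Y).filter fun i => g i = s := by rw [ho]; simp
    rw [mem_filter] at hom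
    rcases o with _ | D
    · exact .inl hom.2.symm
    · by_cases hD : D = C
      · subst hD; exact .inr (.inl hom.2.symm)
      · exact .inr (.inr ⟨D, mem_erase.2 ⟨hD, by simpa using hom.1⟩, hom.2⟩)

theorem false_of_split (hF : Full H A S w) (h : MinCex H A) (hC : C ∈ big H A S w)
    {N₁ N₂ : Finset V} (hN₁ : N₁.Nonempty) (hN₂ : N₂.Nonempty) (hN : N₁ ∪ N₂ = nbr H S C)
    (ht : ∀ s₁ ∈ N₁, ∀ s₂ ∈ N₂, s₁ ≠ s₂ → Tiled H ({s₁, w s₁, s₂, w s₂} ∪ C)) : False := by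
  obtain ⟨s₁, hs₁, s₂, hs₂, hne, g, hg, hginj, hcov⟩ := hF.exists_split h hC hN₁ hN₂ hN
  have hs₁S : s₁ ∈ S := nbr_subset (hN ▸ mem_union_left _ hs₁ : s₁ ∈ nbr H S C)
  have hs₂S : s₂ ∈ S := nbr_subset (hN ▸ mem_union_right _ hs₂ : s₂ ∈ nbr H S C)
  have t1 := ht s₁ hs₁ s₂ hs₂ hne
  set Y := (big H A S w).erase C with hY
  have hYb : ∀ D ∈ Y, D ∈ big H A S w := fun D hD => mem_of_mem_erase hD
  have hgS : ∀ D ∈ Y, g D ∈ S := fun D hD => nbr_subset (hg D hD).1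
  have hcd : ∀ D ∈ big H A S w, ∀ D' ∈ big H A S w, ∀ x, x ∈ D → x ∈ D' → D = D' :=
    fun D hD D' hD' x hx hx' => by
      by_contra hn
      exact disjoint_left.1 (big_disjoint hD hD' hn) hx hx'
  have t2 : Tiled H (Y.biUnion fun D => insert (g D) ({w (g D)} ∪ D)) := by
    refine Tiled.biUnion _ _ (fun D hD => ?_) fun D hD D' hD' hDD => ?_
    · obtain ⟨-, v, hv, hgv⟩ := mem_nbr.1 (hg D hD).1
      refine tiled_star (sun_singleton _) (mem_suns.1 (mem_suns_of_big (hYb D hD))).2 ?_ ?_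
        (notMem_big (hYb D hD) (hgS D hD)) (mem_singleton_self _) hv
        (hF.leaf _ (hgS D hD)).adj hgv
      · simpa using hF.leaf_notMem (hYb D hD) (hgS D hD)
      · simpa using (hF.leaf _ (hgS D hD)).adj.ne
    · rw [disjoint_left]
      intro a ha ha'
      simp only [mem_insert, mem_union, mem_singleton] at ha ha'
      have b := hYb D hD
      have b' := hYb D' hD'
      have c := hgS D hD
      have c' := hgS D' hD'
      rcases ha with rfl | rfl | ha <;> rcases ha' with ha' | ha' | ha'
      · exact hDD (hginj hD hD' ha')
      · exact hF.notMem _ c' (ha' ▸ c)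
      · exact notMem_big b' c ha'
      · exact hF.notMem _ c (ha' ▸ c')
      · exact hDD (hginj hD hD' (hF.leaf_inj c c' ha'))
      · exact hF.leaf_notMem b' c ha'
      · exact notMem_big b c' (ha' ▸ ha)
      · exact hF.leaf_notMem b c' (ha' ▸ ha)
      · exact hDD (hcd D b D' b' a ha ha')
  refine h.not_tiled ?_
  have hfin := t1.union t2 ?_
  · convert hfin using 1
    ext a
    simp only [mem_union, mem_insert, mem_singleton, mem_biUnion]
    constructor
    · intro ha
      rcases hF.mem_cases ha with ha | ⟨s, hs, rfl⟩ | ⟨D, hD, ha⟩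
      · rcases hcov a ha with rfl | rfl | ⟨D, hD, rfl⟩
        · simp
        · simp
        · exact .inr ⟨D, hD, .inl rfl⟩
      · rcases hcov s hs with rfl | rfl | ⟨D, hD, rfl⟩
        · simp
        · simp
        · exact .inr ⟨D, hD, .inr (.inl rfl)⟩
      · by_cases hDC : D = C
        · exact .inl (.inr (hDC ▸ ha))
        · exact .inr ⟨D, mem_erase.2 ⟨hDC, hD⟩, .inr (.inr ha)⟩
    · have hbA : ∀ D ∈ big H A S w, D ⊆ A := fun D hD =>
        (mem_suns.1 (mem_suns_of_big hD)).1.sub.trans sdiff_subset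
      rintro (((rfl | rfl | rfl | rfl) | ha) | ⟨D, hD, rfl | rfl | ha⟩)
      · exact hF.sub hs₁S
      · exact (hF.leaf _ hs₁S).mem
      · exact hF.sub hs₂S
      · exact (hF.leaf _ hs₂S).mem
      · exact hbA C hC ha
      · exact hF.sub (hgS D hD)
      · exact (hF.leaf _ (hgS D hD)).mem
      · exact hbA D (hYb D hD) ha
  · rw [disjoint_left]
    intro a ha ha'
    obtain ⟨D, hD, ha'⟩ := mem_biUnion.1 ha'
    simp only [mem_insert, mem_union, mem_singleton] at ha ha'
    have b := hYb D hD
    have c := hgS D hD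
    have key : ∀ s ∈ S, g D ≠ s → a = s ∨ a = w s → False := by
      intro s hs hgs has
      rcases has with rfl | rfl <;> rcases ha' with ha' | ha' | ha'
      · exact hgs ha'.symm
      · exact hF.notMem _ c (ha' ▸ hs)
      · exact notMem_big b hs ha'
      · exact hF.notMem _ hs (ha' ▸ c)
      · exact hgs (hF.leaf_inj c hs ha'.symm)
      · exact hF.leaf_notMem b hs ha'
    rcases ha with (ha | ha | ha | ha) | ha
    · exact key s₁ hs₁S (hg D hD).2.1 (.inl ha)
    · exact key s₁ hs₁S (hg D hD).2.1 (.inr ha)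
    · exact key s₂ hs₂S (hg D hD).2.2 (.inl ha)
    · exact key s₂ hs₂S (hg D hD).2.2 (.inr ha)
    · rcases ha' with rfl | rfl | ha'
      · exact notMem_big hC c ha
      · exact hF.leaf_notMem hC c ha
      · exact (mem_erase.1 hD).1 (hcd D b C hC a ha' ha)

/-- Every large sun is a corona that is attached to `S` via core vertices only. -/
theorem exists_core (hF : Full H A S w) (h : MinCex H A) (hC : C ∈ big H A S w) :
    ∃ R p, Corona H C R p ∧ ∀ r ∈ R, ∀ s ∈ S, ¬ H.Adj s (p r) := by
  have hcs := mem_suns.1 (mem_suns_of_big hC)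
  by_contra! hno
  have hd : ∀ s₁ ∈ S, ∀ s₂ ∈ S, s₁ ≠ s₂ → w s₁ ≠ w s₂ ∧ s₁ ≠ w s₂ ∧ w s₁ ≠ s₂ :=
    fun s₁ h1 s₂ h2 hne => ⟨fun e => hne (hF.leaf_inj h1 h2 e),
      fun e => hF.notMem s₂ h2 (e ▸ h1), fun e => hF.notMem s₁ h1 (e ▸ h2)⟩
  obtain ⟨z, rfl⟩ | ⟨R, p, hR⟩ := hcs.2
  · have hne := hF.nbr_nonempty h hC
    refine hF.false_of_split h hC hne hne (union_self _) fun s₁ k₁ s₂ k₂ hss => ?_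
    obtain ⟨h1, c, hc, ha1⟩ := mem_nbr.1 k₁
    obtain ⟨h2, c', hc', ha2⟩ := mem_nbr.1 k₂
    rw [mem_singleton] at hc hc'
    subst hc
    subst hc'
    obtain ⟨d1, d2, d3⟩ := hd s₁ h1 s₂ h2 hss
    have n1 : w s₁ ≠ c' := by simpa using hF.leaf_notMem hC h1
    have n2 : w s₂ ≠ c' := by simpa using hF.leaf_notMem hC h2
    have := tiled_five (hF.leaf s₁ h1).adj.symm ha1 ha2.symm (hF.leaf s₂ h2).adj n1 d3 d1 hss d2
      n2.symm
    convert this using 1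
    ext a
    simp only [mem_union, mem_insert, mem_singleton]
    tauto
  obtain ⟨u, hu, s, hs, hsu⟩ := hno R p hR
  have hN₁ : (nbr H S {p u}).Nonempty := ⟨s, mem_nbr.2 ⟨hs, p u, by simp, hsu⟩⟩
  by_cases hone : ∃ u' ∈ R, u ≠ u'
  · obtain ⟨u', hu', huu⟩ := hone
    refine hF.false_of_split h hC hN₁ (hF.nbr_nonempty h hC) (union_eq_right.2 fun t ht => ?_)
      fun s₁ k₁ s₂ k₂ hss => ?_
    · obtain ⟨h1, c, hc, h2⟩ := mem_nbr.1 ht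
      rw [mem_singleton] at hc
      exact mem_nbr.2 ⟨h1, c, hc ▸ hR.pendant_mem hu, h2⟩
    obtain ⟨h1, c, hc, ha1⟩ := mem_nbr.1 k₁
    obtain ⟨h2, v, hv, ha2⟩ := mem_nbr.1 k₂
    rw [mem_singleton] at hc
    subst hc
    obtain ⟨d1, d2, d3⟩ := hd s₁ h1 s₂ h2 hss
    obtain ⟨r, hr, v', hvr⟩ : ∃ r ∈ R, ∃ v', v = r ∧ v' = p r ∨ v = p r ∧ v' = r := by
      rcases hR.cases hv with hv | ⟨r, hr, rfl⟩
      · exact ⟨v, hv, p v, .inl ⟨rfl, rfl⟩⟩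
      · exact ⟨r, hr, r, .inr ⟨rfl, rfl⟩⟩
    by_cases hur : u = r
    · subst hur
      rcases hvr with ⟨rfl, -⟩ | ⟨rfl, -⟩
      · exact hR.tiled_split_core hu (hF.leaf s₁ h1).adj (hF.leaf s₂ h2).adj (notMem_big hC h1)
          (hF.leaf_notMem hC h1) (notMem_big hC h2) (hF.leaf_notMem hC h2) hss d1 d2 d3 ha1 ha2
      · exact hR.tiled_split_pendant hu hu' huu (hF.leaf s₁ h1).adj (hF.leaf s₂ h2).adj
          (notMem_big hC h1) (hF.leaf_notMem hC h1) (notMem_big hC h2) (hF.leaf_notMem hC h2)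
          hss d1 d2 d3 ha1 ha2
    · exact hR.tiled_split_other hu hr hur (hF.leaf s₁ h1).adj (hF.leaf s₂ h2).adj
        (notMem_big hC h1) (hF.leaf_notMem hC h1) (notMem_big hC h2) (hF.leaf_notMem hC h2)
        hss d1 d2 d3 ha1 ha2 hvr
  · push Not at hone
    have hRe : R = {u} := by
      ext a
      rw [mem_singleton]
      exact ⟨fun ha => (hone a ha).symm, fun ha => ha ▸ hu⟩
    have hCe : C = {u, p u} := by
      rw [hR.eq, hRe]
      ext
      simp
    have hcp : Corona H C {p u} fun _ => u := by
      rw [hCe, pair_comm]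
      exact corona_pair (hR.adj u hu).symm
    obtain ⟨-, -, t, ht, htu⟩ := hno _ _ hcp
    refine hF.false_of_split h hC hN₁ (N₂ := nbr H S {u}) ⟨t, mem_nbr.2 ⟨ht, u, by simp, htu⟩⟩ ?_
      fun s₁ k₁ s₂ k₂ hss => ?_
    · ext a
      rw [mem_union, mem_nbr, mem_nbr, mem_nbr, hCe]
      simp only [mem_singleton, mem_insert, exists_eq_left, exists_eq_or_imp]
      tauto
    obtain ⟨h1, c, hc, ha1⟩ := mem_nbr.1 k₁
    obtain ⟨h2, v, hv, ha2⟩ := mem_nbr.1 k₂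
    rw [mem_singleton] at hc hv
    subst hc
    subst hv
    obtain ⟨d1, d2, d3⟩ := hd s₁ h1 s₂ h2 hss
    exact hR.tiled_split_core hu (hF.leaf s₁ h1).adj (hF.leaf s₂ h2).adj (notMem_big hC h1)
          (hF.leaf_notMem hC h1) (notMem_big hC h2) (hF.leaf_notMem hC h2) hss d1 d2 d3 ha1 ha2

end Full

end

section

variable {H H' : SimpleGraph V} {X A B C D R S T U : Finset V} {p : V → V}
variable {Y : Finset (Finset V)}

variable {w : V → V}

namespace Full

theorem leaf_of_core (hC : C ∈ big H A S w) (hR : Corona H C R p)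
    (hp : ∀ r ∈ R, ∀ s ∈ S, ¬ H.Adj s (p r)) {r : V} (hr : r ∈ R) : Leaf H A r (p r) := by
  have hc := (mem_suns.1 (mem_suns_of_big hC)).1
  refine ⟨(mem_sdiff.1 (hc.sub (hR.pendant_mem hr))).1, hR.adj r hr, fun y hy hpy => ?_⟩
  by_cases hyS : y ∈ S
  · exact absurd hpy.symm (hp r hr y hyS)
  · exact hR.uniq r hr y
      (hc.closed _ (hR.pendant_mem hr) y (mem_sdiff.2 ⟨hy, hyS⟩) hpy) hpy

/-- Every vertex of `A` is a leaf or has a leaf. -/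
theorem exists_leaf_or (hF : Full H A S w) (h : MinCex H A) {a : V} (ha : a ∈ A) :
    (∃ b, Leaf H A a b) ∨ ∃ b ∈ A, Leaf H A b a := by
  rcases hF.mem_cases ha with ha | ⟨s, hs, rfl⟩ | ⟨C, hC, ha⟩
  · exact .inl ⟨_, hF.leaf a ha⟩
  · exact .inr ⟨s, hF.sub hs, hF.leaf s hs⟩
  · obtain ⟨R, p, hR, hp⟩ := hF.exists_core h hC
    rcases hR.cases ha with ha | ⟨r, hr, rfl⟩
    · exact .inl ⟨_, leaf_of_core hC hR hp ha⟩
    · have hc := (mem_suns.1 (mem_suns_of_big hC)).1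
      exact .inr ⟨r, (mem_sdiff.1 (hc.sub (hR.core_mem hr))).1, leaf_of_core hC hR hp hr⟩

/-- The vertices with a leaf, other than `x ∈ S`, have a perfect matching. -/
theorem pm_erase (hF : Full H A S w) (h : MinCex H A) {x : V} (hx : x ∈ S) {Q : Finset V}
    (hQ : ∀ a, a ∈ Q ↔ a ∈ A ∧ ∃ b, Leaf H A a b) : PM H (Q.erase x) := by
  have : Nonempty V := ⟨x⟩
  have hcore : ∀ C, ∃ R, C ∈ big H A S w → ∃ p, Corona H C R p ∧
      ∀ r ∈ R, ∀ s ∈ S, ¬ H.Adj s (p r) := fun C => by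
    by_cases hC : C ∈ big H A S w
    · obtain ⟨R, p, hR⟩ := hF.exists_core h hC
      exact ⟨R, fun _ => ⟨p, hR⟩⟩
    · exact ⟨∅, fun hC' => absurd hC' hC⟩
  choose R hR using hcore
  obtain ⟨g, hg, hg1⟩ := exists_assignment 1 (big H A S w) (fun C => (nbr H S C).erase x)
    (S.erase x) (fun C _ => erase_subset_erase _ nbr_subset) (by
      have := hF.card_big
      rw [card_erase_of_mem hx]
      omega) fun K hK => by
      rcases K.eq_empty_or_nonempty with rfl | hne
      · simp
      have h1 := hF.card_add_one_le' h hK hne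
      have h2 : (K.biUnion (nbr H S)).erase x ⊆ K.biUnion fun C => (nbr H S C).erase x := by
        intro a ha
        simp only [mem_erase, mem_biUnion] at ha ⊢
        obtain ⟨hax, C, hC, ha⟩ := ha
        exact ⟨C, hC, hax, ha⟩
      have h3 := card_le_card h2
      have h4 := pred_card_le_card_erase (s := K.biUnion (nbr H S)) (a := x)
      omega
  have hgS : ∀ C ∈ big H A S w, g C ∈ S := fun C hC => nbr_subset (mem_of_mem_erase (hg C hC))
  have hinj : ∀ C ∈ big H A S w, ∀ D ∈ big H A S w, g C = g D → C = D := fun C hC D hD e =>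
    card_le_one.1 (hg1 (g D) (mem_erase.2 ⟨(mem_erase.1 (hg D hD)).1, hgS D hD⟩)).le
      C (mem_filter.2 ⟨hC, e⟩) D (mem_filter.2 ⟨hD, rfl⟩)
  have hRC : ∀ C ∈ big H A S w, R C ⊆ C := fun C hC r hr => by
    obtain ⟨p, hp, -⟩ := hR C hC
    exact hp.core_mem hr
  have hbA : ∀ D ∈ big H A S w, D ⊆ A := fun D hD =>
    (mem_suns.1 (mem_suns_of_big hD)).1.sub.trans sdiff_subset
  have key : PM H ((big H A S w).biUnion fun C => insert (g C) (R C)) := by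
    refine PM.biUnion _ _ (fun C hC => ?_) fun C hC D hD hne => ?_
    · obtain ⟨p, hp, hpS⟩ := hR C hC
      obtain ⟨-, v, hv, hgv⟩ := mem_nbr.1 (mem_of_mem_erase (hg C hC))
      have hvR : v ∈ R C := by
        rcases hp.cases hv with hv | ⟨r, hr, rfl⟩
        · exact hv
        · exact absurd hgv (hpS r hr _ (hgS C hC))
      have h1 := (PM.pair hgv).union (hp.fc.2 v hvR) (by
        rw [disjoint_left]
        intro a ha ha'
        rw [mem_erase] at ha'
        simp only [mem_insert, mem_singleton] at ha
        rcases ha with rfl | rfl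
        · exact notMem_big hC (hgS C hC) (hRC C hC ha'.2)
        · exact ha'.1 rfl)
      convert h1 using 1
      ext a
      simp only [mem_insert, mem_union, mem_singleton, mem_erase]
      by_cases hav : a = v
      · simp [hav, hvR]
      · simp [hav]
    · rw [disjoint_left]
      intro a ha ha'
      rw [mem_insert] at ha ha'
      rcases ha with rfl | ha <;> rcases ha' with ha' | ha'
      · exact hne (hinj C hC D hD ha')
      · exact notMem_big hD (hgS C hC) (hRC D hD ha')
      · exact notMem_big hC (hgS D hD) (ha' ▸ hRC C hC ha)
      · exact disjoint_left.1 (big_disjoint hC hD hne) (hRC C hC ha) (hRC D hD ha')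
  convert key using 1
  ext a
  simp only [mem_erase, mem_biUnion, mem_insert, hQ]
  constructor
  · rintro ⟨hax, haA, b, hb⟩
    rcases hF.mem_cases haA with ha | ⟨s, hs, rfl⟩ | ⟨C, hC, ha⟩
    · obtain ⟨C, hC⟩ := card_eq_one.1 (hg1 a (mem_erase.2 ⟨hax, ha⟩))
      have hCm : C ∈ (big H A S w).filter fun C => g C = a := by rw [hC]; simp
      rw [mem_filter] at hCm
      exact ⟨C, hCm.1, .inl hCm.2.symm⟩
    · exact absurd (hF.leaf s hs) (h.not_leaf haA hb)
    · obtain ⟨p, hp, hpS⟩ := hR C hC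
      rcases hp.cases ha with ha | ⟨r, hr, rfl⟩
      · exact ⟨C, hC, .inr ha⟩
      · exact absurd (leaf_of_core hC hp hpS hr) (h.not_leaf haA hb)
  · rintro ⟨C, hC, rfl | ha⟩
    · exact ⟨(mem_erase.1 (hg C hC)).1, hF.sub (hgS C hC), _, hF.leaf _ (hgS C hC)⟩
    · obtain ⟨p, hp, hpS⟩ := hR C hC
      refine ⟨?_, hbA C hC (hRC C hC ha), _, leaf_of_core hC hp hpS ha⟩
      rintro rfl
      exact notMem_big hC hx (hRC C hC ha)

end Full

/-- There is no minimal counterexample. -/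
theorem MinCex.false (h : MinCex H A) : False := by
  classical
  set Q := A.filter fun a => ∃ b, Leaf H A a b with hQdef
  have hQ : ∀ a, a ∈ Q ↔ a ∈ A ∧ ∃ b, Leaf H A a b := fun a => by rw [hQdef, mem_filter]
  have hlf : ∀ a, ∃ b, a ∈ Q → Leaf H A a b := fun a => by
    by_cases ha : a ∈ Q
    · obtain ⟨b, hb⟩ := ((hQ a).1 ha).2
      exact ⟨b, fun _ => hb⟩
    · exact ⟨a, fun h => absurd h ha⟩
  choose q hq using hlf
  have hfull : ∀ x ∈ Q, ∃ S w, x ∈ S ∧ Full H A S w := fun x hx => by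
    have hxA := ((hQ x).1 hx).1
    have h1 := h.strict (S := {x}) (by simpa using hxA) (by simp)
    have h2 := card_pos.2 ⟨_, (hq x hx).mem_suns (S := {x}) (by simp)
      (by simpa using (hq x hx).adj.ne')⟩
    refine h.exists_full (S := {x}) (by simpa using hxA) ?_ (by simp)
    rw [card_singleton] at h1 ⊢
    omega
  have hQne : Q.Nonempty := by
    obtain ⟨S, hS, hsl⟩ := h.exists_slack_one
    have hne : S.Nonempty := by rw [← card_pos]; omega
    obtain ⟨s, hs⟩ := hne
    exact ⟨s, (hQ s).2 ⟨hS hs, h.exists_leaf hS hsl hs⟩⟩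
  refine h.not_sun (.inr ⟨Q, q, ⟨hQne, fun x hx => ?_⟩, ?_, ?_, ?_, fun r hr => (hq r hr).adj,
    fun r hr => (hq r hr).uniq⟩)
  · obtain ⟨S, w, hxS, hF⟩ := hfull x hx
    exact hF.pm_erase h hxS hQ
  · obtain ⟨x, hx⟩ := hQne
    obtain ⟨S, w, hxS, hF⟩ := hfull x hx
    ext a
    simp only [mem_union, mem_image]
    constructor
    · intro ha
      rcases hF.exists_leaf_or h ha with hl | ⟨b, hb, hl⟩
      · exact .inl ((hQ a).2 ⟨ha, hl⟩)
      · have hbQ := (hQ b).2 ⟨hb, a, hl⟩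
        exact .inr ⟨b, hbQ, h.leaf_unique hb (hq b hbQ) hl⟩
    · rintro (ha | ⟨b, hb, rfl⟩)
      · exact ((hQ a).1 ha).1
      · exact (hq b hb).mem
  · intro a ha b hb e
    exact (hq b hb).uniq a ((hQ a).1 ha).1 (e ▸ (hq a ha).adj.symm)
  · intro r hr hqr
    exact h.not_leaf (hq r hr).mem ((hq _ hqr)) (hq r hr)

/-- The sufficiency part of Kaneko's theorem. -/
theorem Kan.tiled [Finite V] (h : Kan H A) : Tiled H A := by
  induction hn : A.card + H.edgeSet.ncard using Nat.strong_induction_on generalizing H A with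
  | _ n ih =>
  by_contra hnt
  refine MinCex.false (H := H) (A := A) ⟨fun H' A' hH hA hne hK => ?_, h, hnt⟩
  refine ih _ ?_ hK rfl
  have h1 := card_le_card hA
  have h2 : H'.edgeSet ⊆ H.edgeSet := SimpleGraph.edgeSet_subset_edgeSet.2 hH
  have h3 := Set.ncard_le_ncard h2 (Set.toFinite _)
  rcases hne with hne | hne
  · have := card_lt_card (hA.ssubset_of_ne hne)
    omega
  · have : H'.edgeSet.ncard < H.edgeSet.ncard :=
      Set.ncard_lt_ncard (h2.ssubset_of_ne fun e => hne (SimpleGraph.edgeSet_inj.1 e))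
        (Set.toFinite _)
    omega

end

section

variable {H H' : SimpleGraph V} {X A B C D R S T U : Finset V} {p : V → V}
variable {Y : Finset (Finset V)}

/-! ### Path factors -/

/-- The component of `v` in `F` is a path on three to five vertices. -/
def Chart (F : SimpleGraph V) (v : V) : Prop :=
  ∃ n, 3 ≤ n ∧ n ≤ 5 ∧ ∃ f : Fin n → V, Function.Injective f ∧ (∃ i, f i = v) ∧
    ∀ i b, F.Adj (f i) b ↔ ∃ j, (SimpleGraph.pathGraph n).Adj i j ∧ f j = b

variable {F : SimpleGraph V}

theorem Chart.isPathOn {v : V} (h : Chart F v) :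
    IsPathOn (F.induce (F.connectedComponentMk v).supp) 3 ∨
    IsPathOn (F.induce (F.connectedComponentMk v).supp) 4 ∨
    IsPathOn (F.induce (F.connectedComponentMk v).supp) 5 := by
  obtain ⟨n, h3, h5, f, hf, ⟨i₀, rfl⟩, hadj⟩ := h
  suffices h : IsPathOn (F.induce (F.connectedComponentMk (f i₀)).supp) n by
    interval_cases n
    · exact .inl h
    · exact .inr (.inl h)
    · exact .inr (.inr h)
  obtain ⟨k, rfl⟩ : ∃ k, n = k + 1 := ⟨n - 1, by omega⟩
  let φ : SimpleGraph.pathGraph (k + 1) →g F := ⟨f, fun {a b} hab => (hadj a _).2 ⟨b, hab, rfl⟩⟩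
  have hmem : ∀ i, f i ∈ (F.connectedComponentMk (f i₀)).supp := fun i =>
    SimpleGraph.ConnectedComponent.sound
      (((SimpleGraph.pathGraph_connected k).preconnected i i₀).map φ)
  have hsurj : ∀ w, F.Reachable (f i₀) w → ∃ i, f i = w := by
    intro w hw
    rw [SimpleGraph.reachable_iff_reflTransGen] at hw
    induction hw with
    | refl => exact ⟨i₀, rfl⟩
    | tail _ hbc ih =>
      obtain ⟨i, rfl⟩ := ih
      obtain ⟨j, -, hj⟩ := (hadj i _).1 hbc
      exact ⟨j, hj⟩
  have hbij : Function.Bijective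
      (fun i => (⟨f i, hmem i⟩ : (F.connectedComponentMk (f i₀)).supp)) := by
    refine ⟨fun i j hij => hf (congrArg Subtype.val hij), fun w => ?_⟩
    obtain ⟨i, hi⟩ := hsurj w.1 (SimpleGraph.ConnectedComponent.exact w.2).symm
    exact ⟨i, Subtype.ext hi⟩
  refine ⟨SimpleGraph.Iso.symm ⟨Equiv.ofBijective _ hbij, ?_⟩⟩
  intro a b
  simp only [Equiv.ofBijective_apply, SimpleGraph.comap_adj, Function.Embedding.subtype_apply]
  rw [hadj]
  exact ⟨fun ⟨j, h, hj⟩ => hf hj ▸ h, fun h => ⟨b, h, rfl⟩⟩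

theorem chart_of_isPathOn {v : V} {n : ℕ} (h3 : 3 ≤ n) (h5 : n ≤ 5)
    (h : IsPathOn (F.induce (F.connectedComponentMk v).supp) n) : Chart F v := by
  obtain ⟨e⟩ := h
  refine ⟨n, h3, h5, fun i => (e.symm i).1, fun i j hij => e.symm.injective (Subtype.ext hij),
    ⟨e ⟨v, rfl⟩, by simp⟩, fun i b => ⟨fun hb => ?_, ?_⟩⟩
  · have hb' : b ∈ (F.connectedComponentMk v).supp :=
      SimpleGraph.ConnectedComponent.mem_supp_of_adj_mem_supp _ (e.symm i).2 hb
    refine ⟨e ⟨b, hb'⟩, ?_, by simp⟩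
    have : (F.induce (F.connectedComponentMk v).supp).Adj (e.symm i) ⟨b, hb'⟩ := hb
    simpa using e.map_adj_iff.2 this
  · rintro ⟨j, hj, rfl⟩
    exact e.symm.map_adj_iff.2 hj

theorem hasPPPFactor_iff_chart : HasPPPFactor H ↔ ∃ F ≤ H, ∀ v, Chart F v := by
  refine ⟨fun ⟨F, hF, h⟩ => ⟨F, hF, fun v => ?_⟩, fun ⟨F, hF, h⟩ => ⟨F, hF, fun c => ?_⟩⟩
  · rcases h (F.connectedComponentMk v) with h | h | h
    · exact chart_of_isPathOn (by omega) (by omega) h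
    · exact chart_of_isPathOn (by omega) (by omega) h
    · exact chart_of_isPathOn (by omega) (by omega) h
  · induction c using SimpleGraph.ConnectedComponent.ind with
    | _ v => exact (h v).isPathOn

theorem Tiled.exists_chart (h : Tiled H A) :
    ∃ F ≤ H, (∀ a b, F.Adj a b → a ∈ A) ∧ ∀ a ∈ A, Chart F a := by
  induction h with
  | empty => exact ⟨⊥, bot_le, by simp, by simp⟩
  | @cons A l hnd hch h3 h5 hdisj _ ih =>
    obtain ⟨F, hF, hFA, hc⟩ := ih
    let P : SimpleGraph V := (SimpleGraph.pathGraph l.length).map l.get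
    have hPl : ∀ a b, P.Adj a b → a ∈ l.toFinset := by
      rintro a b ⟨-, i, j, hij, rfl, rfl⟩
      simp
    have hPH : P ≤ H := by
      rintro a b ⟨-, i, j, hij, rfl, rfl⟩
      rw [List.isChain_iff_getElem] at hch
      rw [SimpleGraph.pathGraph_adj] at hij
      rcases hij with hij | hij
      · have := hch i (by omega)
        simpa [hij] using this
      · have := (hch j (by omega)).symm
        simpa [hij] using this
    have hlA : ∀ a ∈ l.toFinset, a ∉ A := fun _ ha => disjoint_left.1 hdisj ha
    refine ⟨F ⊔ P, sup_le hF hPH, ?_, fun a ha => ?_⟩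
    · rintro a b (hab | hab)
      · exact mem_union_right _ (hFA _ _ hab)
      · exact mem_union_left _ (hPl _ _ hab)
    · rcases mem_union.1 ha with ha | ha
      · obtain ⟨i, hi⟩ := List.get_of_mem (List.mem_toFinset.1 ha)
        refine ⟨l.length, h3, h5, l.get, hnd.injective_get, ⟨i, hi⟩, fun i b => ⟨?_, ?_⟩⟩
        · rintro (hab | ⟨-, i', j, hij, h1, h2⟩)
          · exact absurd (hFA _ _ hab) (hlA _ (by simp))
          · exact ⟨j, hnd.injective_get h1 ▸ hij, h2⟩
        · rintro ⟨j, hij, rfl⟩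
          exact .inr ⟨hnd.injective_get.ne hij.ne, i, j, hij, rfl, rfl⟩
      · obtain ⟨n, h3', h5', f, hf, hi, hadj⟩ := hc a ha
        have hfA : ∀ i, f i ∈ A := by
          intro i
          have : ∃ j, (SimpleGraph.pathGraph n).Adj i j := by
            simp only [SimpleGraph.pathGraph_adj]
            by_cases h : i.1 = 0
            · exact ⟨⟨1, by omega⟩, by simp [h]⟩
            · exact ⟨⟨i.1 - 1, by omega⟩, by right; simp; omega⟩
          obtain ⟨j, hj⟩ := this
          exact hFA _ _ ((hadj i _).2 ⟨j, hj, rfl⟩)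
        refine ⟨n, h3', h5', f, hf, hi, fun i b => ?_⟩
        rw [← hadj]
        refine ⟨?_, .inl⟩
        rintro (h | h)
        · exact h
        · exact absurd (hfA i) (hlA _ (hPl _ _ h))

theorem Chart.exists_adj {v : V} (h : Chart F v) : ∃ b, F.Adj v b := by
  obtain ⟨n, h3, h5, f, hf, ⟨i, rfl⟩, hadj⟩ := h
  simp only [hadj, SimpleGraph.pathGraph_adj]
  by_cases h : i.1 = 0
  · exact ⟨_, ⟨1, by omega⟩, by simp [h], rfl⟩
  · exact ⟨_, ⟨i.1 - 1, by omega⟩, by right; simp; omega, rfl⟩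

theorem Chart.neighbors {v a b c : V} (h : Chart F v) (ha : F.Adj v a) (hb : F.Adj v b)
    (hc : F.Adj v c) : a = b ∨ a = c ∨ b = c := by
  obtain ⟨n, h3, h5, f, hf, ⟨i, rfl⟩, hadj⟩ := h
  simp only [hadj, SimpleGraph.pathGraph_adj] at ha hb hc
  obtain ⟨ja, ha, rfl⟩ := ha
  obtain ⟨jb, hb, rfl⟩ := hb
  obtain ⟨jc, hc, rfl⟩ := hc
  have : ja = jb ∨ ja = jc ∨ jb = jc := by simp only [Fin.ext_iff]; omega
  rcases this with rfl | rfl | rfl <;> simp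

theorem Chart.exists_third {a b : V} (h : Chart F a) (hab : F.Adj a b) :
    ∃ c, c ≠ a ∧ c ≠ b ∧ (F.Adj a c ∨ F.Adj b c) := by
  obtain ⟨n, h3, h5, f, hf, ⟨i, rfl⟩, hadj⟩ := h
  obtain ⟨j, hij, rfl⟩ := (hadj _ _).1 hab
  rw [SimpleGraph.pathGraph_adj] at hij
  have : ∃ k : Fin n, k ≠ i ∧ k ≠ j ∧ ((SimpleGraph.pathGraph n).Adj i k ∨
      (SimpleGraph.pathGraph n).Adj j k) := by
    simp only [SimpleGraph.pathGraph_adj, ne_eq, Fin.ext_iff]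
    have hi := i.2
    have hj := j.2
    rcases hij with hij | hij
    · by_cases h0 : i.1 = 0
      · exact ⟨⟨2, by omega⟩, by simp; omega⟩
      · exact ⟨⟨i.1 - 1, by omega⟩, by simp; omega⟩
    · by_cases h0 : j.1 = 0
      · exact ⟨⟨2, by omega⟩, by simp; omega⟩
      · exact ⟨⟨j.1 - 1, by omega⟩, by simp; omega⟩
  obtain ⟨k, h1, h2, h⟩ := this
  refine ⟨f k, hf.ne h1, hf.ne h2, h.imp (fun h => ?_) (fun h => ?_)⟩
  · exact (hadj _ _).2 ⟨k, h, rfl⟩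
  · exact (hadj _ _).2 ⟨k, h, rfl⟩

end

section

variable {H H' : SimpleGraph V} {X A B C D R S T U : Finset V} {p : V → V}
variable {Y : Finset (Finset V)}

/-! ### Necessity -/

variable {F : SimpleGraph V}

theorem Sun.exists_adj_notMem (hF : F ≤ H) (hc : ∀ v, Chart F v) (hC : Sun H C) :
    ∃ x ∈ C, ∃ y ∉ C, F.Adj x y := by
  by_contra! hcl
  replace hcl : ∀ x ∈ C, ∀ y, F.Adj x y → y ∈ C := fun x hx y hxy => by
    by_contra hy
    exact hcl x hx y hy hxy
  rcases hC with ⟨x, rfl⟩ | ⟨R, p, h⟩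
  · obtain ⟨b, hb⟩ := (hc x).exists_adj
    exact hb.ne (mem_singleton.1 (hcl x (mem_singleton_self x) b hb)).symm
  have hRC : ∀ r ∈ R, r ∈ C := fun r hr => h.eq ▸ mem_union_left _ hr
  have hpC : ∀ r ∈ R, p r ∈ C := fun r hr => h.eq ▸ mem_union_right _ (mem_image_of_mem p hr)
  have hpr : ∀ r ∈ R, ∀ y, F.Adj (p r) y → y = r := fun r hr y hy =>
    h.uniq r hr y (hcl _ (hpC r hr) y hy) (hF hy)
  have hFp : ∀ r ∈ R, F.Adj r (p r) := fun r hr => by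
    obtain ⟨b, hb⟩ := (hc (p r)).exists_adj
    exact hpr r hr b hb ▸ hb.symm
  have hm : ∀ r ∈ R, ∃ c ∈ R, F.Adj r c := fun r hr => by
    obtain ⟨c, h1, h2, h3⟩ := (hc r).exists_third (hFp r hr)
    have h4 : F.Adj r c := h3.resolve_right fun h3 => h1 (hpr r hr c h3)
    refine ⟨c, ?_, h4⟩
    have h5 := hcl r (hRC r hr) c h4
    rw [h.eq, mem_union, mem_image] at h5
    rcases h5 with h5 | ⟨r', hr', rfl⟩
    · exact h5
    · exact absurd (congrArg p (hpr r' hr' r h4.symm)).symm h2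
  choose! m hmR hmF using hm
  have hPM : PM H R := by
    refine ⟨m, fun r hr => ⟨hmR r hr, hF (hmF r hr), ?_⟩⟩
    have hne : ∀ c ∈ R, c ≠ p (m r) := fun c hc hcp => h.notMem (m r) (hmR r hr) (hcp ▸ hc)
    rcases (hc (m r)).neighbors (hmF r hr).symm (hmF _ (hmR r hr)) (hFp _ (hmR r hr)) with
      h1 | h1 | h1
    · exact h1.symm
    · exact absurd h1 (hne r hr)
    · exact absurd h1 (hne _ (hmR _ (hmR r hr)))
  exact (Nat.not_even_iff_odd.2 h.fc.odd) hPM.even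

theorem kan_of_chart [Fintype V] (hF : F ≤ H) (hc : ∀ v, Chart F v) : Kan H univ := by
  intro S _
  have key : ∀ C ∈ suns H (univ \ S), ∃ s ∈ S, ∃ x ∈ C, F.Adj s x := by
    intro C hC
    rw [mem_suns] at hC
    obtain ⟨x, hx, y, hy, hxy⟩ := hC.2.exists_adj_notMem hF hc
    refine ⟨y, ?_, x, hx, hxy.symm⟩
    by_contra hyS
    exact hy (hC.1.closed x hx y (mem_sdiff.2 ⟨mem_univ _, hyS⟩) (hF hxy))
  rcases isEmpty_or_nonempty V with hV | hV
  · have : suns H (univ \ S) = ∅ := by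
      refine eq_empty_of_forall_notMem fun C hC => ?_
      obtain ⟨s, -⟩ := key C hC
      exact hV.elim s
    rw [this]
    exact Nat.zero_le _
  choose! s hsS x hxC hsx using key
  refine card_le_mul_card_image_of_maps_to hsS 2 fun b _ => ?_
  by_contra! hlt
  obtain ⟨C₁, h₁, C₂, h₂, C₃, h₃, h12, h13, h23⟩ := two_lt_card.1 hlt
  rw [mem_filter] at h₁ h₂ h₃
  have hdis : ∀ C ∈ suns H (univ \ S), ∀ D ∈ suns H (univ \ S), x C = x D → C = D :=
    fun C hC D hD hx => (mem_suns.1 hC).1.eq_of_mem (mem_suns.1 hD).1 (hxC C hC) (hx ▸ hxC D hD)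
  rcases (hc b).neighbors (h₁.2 ▸ hsx C₁ h₁.1) (h₂.2 ▸ hsx C₂ h₂.1) (h₃.2 ▸ hsx C₃ h₃.1) with
    h | h | h
  · exact h12 (hdis _ h₁.1 _ h₂.1 h)
  · exact h13 (hdis _ h₁.1 _ h₃.1 h)
  · exact h23 (hdis _ h₂.1 _ h₃.1 h)

end

section

variable {H H' : SimpleGraph V} {X A B C D R S T U : Finset V} {p : V → V}
variable {Y : Finset (Finset V)}

/-! ### Comparison with subgraphs on subtypes -/

/-- The injection `f` identifies the graph `L` with `H[C]`. -/
structure Copy {W : Type*} (L : SimpleGraph W) (H : SimpleGraph V) (f : W → V)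
    (C : Finset V) : Prop where
  inj : Function.Injective f
  adj : ∀ a b, L.Adj a b ↔ H.Adj (f a) (f b)
  mem : ∀ v, v ∈ C ↔ ∃ a, f a = v

namespace Copy

variable {W : Type*} {L : SimpleGraph W} {f : W → V}

theorem mem_apply (h : Copy L H f C) (a : W) : f a ∈ C := (h.mem _).2 ⟨a, rfl⟩

theorem induce (h : Copy L H f C) {Z : Set W} (hD : ∀ v, v ∈ D ↔ ∃ a ∈ Z, f a = v) :
    Copy (L.induce Z) H (fun a : Z => f a) D :=
  ⟨h.inj.comp Subtype.val_injective, fun a b => h.adj a b, fun v => by simp [hD]⟩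

theorem pm_iff (h : Copy L H f C) : (∃ M : L.Subgraph, M.IsPerfectMatching) ↔ PM H C := by
  constructor
  · rintro ⟨M, hM⟩
    rw [SimpleGraph.Subgraph.isPerfectMatching_iff] at hM
    choose m hm hu using hM
    refine ⟨Function.extend f (f ∘ m) id, fun v hv => ?_⟩
    obtain ⟨a, rfl⟩ := (h.mem v).1 hv
    rw [h.inj.extend_apply, Function.comp_apply, h.inj.extend_apply, Function.comp_apply]
    refine ⟨h.mem_apply _, (h.adj _ _).1 (M.adj_sub (hm a)), ?_⟩
    rw [← hu (m a) a (hm a).symm]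
  · rintro ⟨m, hm⟩
    have hex : ∀ a, ∃ b, f b = m (f a) := fun a => (h.mem _).1 (hm _ (h.mem_apply a)).1
    choose m₀ hm₀ using hex
    have hinv : ∀ a, m₀ (m₀ a) = a := fun a => h.inj <| by
      rw [hm₀, hm₀, (hm _ (h.mem_apply a)).2.2]
    let M : L.Subgraph :=
      { verts := Set.univ
        Adj := fun a b => m₀ a = b
        adj_sub := by
          rintro a b rfl
          rw [h.adj, hm₀]
          exact (hm _ (h.mem_apply a)).2.1
        edge_vert := fun _ => trivial
        symm := by
          constructor
          rintro a b rfl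
          exact hinv a }
    exact ⟨M, SimpleGraph.Subgraph.isPerfectMatching_iff.2 fun a =>
      ⟨m₀ a, rfl, fun b (hb : m₀ a = b) => Eq.symm hb⟩⟩

theorem isFactorCritical_iff (h : Copy L H f C) :
    IsFactorCritical L ↔ ∀ x ∈ C, PM H (C.erase x) := by
  have key : ∀ a, (∃ M : (L.induce {y : W | y ≠ a}).Subgraph, M.IsPerfectMatching) ↔
      PM H (C.erase (f a)) := fun a => by
    refine (h.induce fun v => ?_).pm_iff
    rw [mem_erase, h.mem]
    constructor
    · rintro ⟨hne, b, rfl⟩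
      exact ⟨b, fun hb => hne (congrArg f hb), rfl⟩
    · rintro ⟨b, hb, rfl⟩
      exact ⟨h.inj.ne hb, b, rfl⟩
  unfold IsFactorCritical
  simp only [key]
  exact ⟨fun H x hx => by obtain ⟨a, rfl⟩ := (h.mem x).1 hx; exact H a,
    fun H a => H _ (h.mem_apply a)⟩

theorem sun_of_isSun (h : Copy L H f C) (hne : C.Nonempty) (hL : IsSun L) : Sun H C := by
  classical
  rcases hL with hL | ⟨hL, hadj⟩ | ⟨R, p, hR, hadj, huniq⟩
  · obtain ⟨hs, ⟨a⟩⟩ := Nat.card_eq_one_iff_unique.1 hL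
    refine .inl ⟨f a, ?_⟩
    ext v
    rw [h.mem, mem_singleton]
    exact ⟨fun ⟨b, hb⟩ => by rw [← hb, Subsingleton.elim a b], fun hv => ⟨a, hv.symm⟩⟩
  · obtain ⟨a, b, hab, huniv⟩ := Nat.card_eq_two_iff.1 hL
    have hC : C = {f a, f b} := by
      ext v
      rw [h.mem, mem_insert, mem_singleton]
      constructor
      · rintro ⟨c, rfl⟩
        have : c ∈ ({a, b} : Set W) := huniv ▸ Set.mem_univ c
        rcases this with rfl | rfl
        · exact .inl rfl
        · exact .inr rfl
      · rintro (rfl | rfl)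
        · exact ⟨_, rfl⟩
        · exact ⟨_, rfl⟩
    exact hC ▸ sun_pair ((h.adj _ _).1 (hadj a b hab))
  · let R' : Finset V := C.filter fun v => ∃ a ∈ R, f a = v
    have hR' : ∀ v, v ∈ R' ↔ ∃ a ∈ R, f a = v := fun v => by
      refine mem_filter.trans ⟨fun hv => hv.2, fun hv => ⟨?_, hv⟩⟩
      obtain ⟨a, -, rfl⟩ := hv
      exact h.mem_apply a
    have hR'f : ∀ a, f a ∈ R' ↔ a ∈ R := fun a => by
      rw [hR']
      exact ⟨fun ⟨b, hb, hba⟩ => h.inj hba ▸ hb, fun ha => ⟨a, ha, rfl⟩⟩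
    let q : V → V := Function.extend f (fun a => if ha : a ∈ R then f (p ⟨a, ha⟩) else f a) id
    have hq : ∀ a : R, q (f a) = f (p a) := fun a => by
      simp only [q, h.inj.extend_apply, a.2, dif_pos, Subtype.coe_eta]
    refine .inr ⟨R', q, ⟨⟨?_, (h.induce hR').isFactorCritical_iff.1 hR⟩, ?_, ?_, ?_, ?_, ?_⟩⟩
    · obtain ⟨v, hv⟩ := hne
      obtain ⟨a, rfl⟩ := (h.mem v).1 hv
      by_cases ha : a ∈ R
      · exact ⟨f a, (hR'f a).2 ha⟩
      · exact ⟨f (p.symm ⟨a, ha⟩), (hR'f _).2 (p.symm ⟨a, ha⟩).2⟩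
    · ext v
      rw [mem_union, mem_image]
      constructor
      · intro hv
        obtain ⟨a, rfl⟩ := (h.mem v).1 hv
        by_cases ha : a ∈ R
        · exact .inl ((hR'f a).2 ha)
        · refine .inr ⟨f (p.symm ⟨a, ha⟩), (hR'f _).2 (p.symm ⟨a, ha⟩).2, ?_⟩
          rw [hq, Equiv.apply_symm_apply]
      · rintro (hv | ⟨w, hw, rfl⟩)
        · exact (mem_filter.1 hv).1
        · obtain ⟨a, ha, rfl⟩ := (hR' w).1 hw
          rw [hq ⟨a, ha⟩]
          exact h.mem_apply _
    · intro v hv w hw hvw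
      obtain ⟨a, ha, rfl⟩ := (hR' v).1 hv
      obtain ⟨b, hb, rfl⟩ := (hR' w).1 hw
      rw [hq ⟨a, ha⟩, hq ⟨b, hb⟩] at hvw
      have := p.injective (Subtype.ext (h.inj hvw))
      rw [Subtype.mk.injEq] at this
      rw [this]
    · intro v hv
      obtain ⟨a, ha, rfl⟩ := (hR' v).1 hv
      rw [hq ⟨a, ha⟩, hR'f]
      exact (p ⟨a, ha⟩).2
    · intro v hv
      obtain ⟨a, ha, rfl⟩ := (hR' v).1 hv
      rw [hq ⟨a, ha⟩, ← h.adj]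
      exact hadj ⟨a, ha⟩
    · intro v hv y hy hvy
      obtain ⟨a, ha, rfl⟩ := (hR' v).1 hv
      obtain ⟨b, rfl⟩ := (h.mem y).1 hy
      rw [hq ⟨a, ha⟩, ← h.adj, huniq, Equiv.symm_apply_apply] at hvy
      rw [hvy]

theorem isSun_of_sun (h : Copy L H f C) (hC : Sun H C) : IsSun L := by
  rcases hC with ⟨x, rfl⟩ | ⟨R, p, hR⟩
  · obtain ⟨a, ha⟩ := (h.mem x).1 (mem_singleton_self x)
    refine .inl (Nat.card_eq_one_iff_unique.2 ⟨⟨fun b c => h.inj ?_⟩, ⟨a⟩⟩)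
    rw [mem_singleton.1 (h.mem_apply b), mem_singleton.1 (h.mem_apply c)]
  · have hex : ∀ a : {a | f a ∈ R}, ∃ b : ({a | f a ∈ R}ᶜ : Set W), f b = p (f a) := by
      rintro ⟨a, ha⟩
      obtain ⟨b, hb⟩ := (h.mem _).1 (hR.pendant_mem ha)
      exact ⟨⟨b, fun hbR => hR.notMem _ ha (hb ▸ hbR)⟩, hb⟩
    choose q hq using hex
    have hbij : Function.Bijective q := by
      refine ⟨fun a b hab => ?_, fun b => ?_⟩
      · refine Subtype.ext (h.inj (hR.inj a.2 b.2 ?_))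
        rw [← hq, ← hq, hab]
      · rcases hR.cases (h.mem_apply b) with hb | ⟨r, hr, hb⟩
        · exact absurd hb b.2
        · obtain ⟨a, rfl⟩ := (h.mem r).1 (hR.core_mem hr)
          exact ⟨⟨a, hr⟩, Subtype.ext (h.inj ((hq _).trans (by simpa using hb.symm)))⟩
    refine .inr (.inr ⟨{a | f a ∈ R}, Equiv.ofBijective q hbij, ?_, fun a => ?_, fun u x => ?_⟩)
    · refine (h.induce fun v => ?_).isFactorCritical_iff.2 hR.fc.2
      constructor
      · intro hv
        obtain ⟨a, rfl⟩ := (h.mem v).1 (hR.core_mem hv)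
        exact ⟨a, hv, rfl⟩
      · rintro ⟨a, ha, rfl⟩
        exact ha
    · rw [h.adj, Equiv.ofBijective_apply, hq]
      exact hR.adj _ a.2
    · obtain ⟨a, rfl⟩ := (Equiv.ofBijective q hbij).surjective u
      rw [Equiv.symm_apply_apply, Equiv.ofBijective_apply, h.adj, hq]
      refine ⟨fun hx => h.inj (hR.uniq _ a.2 _ (h.mem_apply x) hx), ?_⟩
      rintro rfl
      exact (hR.adj _ a.2).symm

end Copy

/-! ### Components of `G - S` -/

section

variable [Fintype V] (G : SimpleGraph V) (S : Set V)

open Classical in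
/-- The vertex set of a component of `G - S`. -/
noncomputable def compSet (c : (G.induce Sᶜ).ConnectedComponent) : Finset V :=
  univ.filter fun v => ∃ hv : v ∈ Sᶜ, (G.induce Sᶜ).connectedComponentMk ⟨v, hv⟩ = c

variable {G S}

theorem mem_compSet {c : (G.induce Sᶜ).ConnectedComponent} {v : V} :
    v ∈ compSet G S c ↔ ∃ hv : v ∈ Sᶜ, (G.induce Sᶜ).connectedComponentMk ⟨v, hv⟩ = c := by
  simp [compSet]

theorem comp_compSet (hX : ∀ v, v ∈ X ↔ v ∉ S) (c : (G.induce Sᶜ).ConnectedComponent) :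
    Comp G X (compSet G S c) := by
  refine ⟨fun v hv => ?_, ?_, ?_, fun B hB hne hcl => ?_⟩
  · obtain ⟨hv, -⟩ := mem_compSet.1 hv
    exact (hX v).2 hv
  · induction c using SimpleGraph.ConnectedComponent.ind with
    | _ v => exact ⟨v, mem_compSet.2 ⟨v.2, rfl⟩⟩
  · intro x hx y hy hxy
    obtain ⟨hxS, rfl⟩ := mem_compSet.1 hx
    have hyS : y ∈ Sᶜ := (hX y).1 hy
    refine mem_compSet.2 ⟨hyS, SimpleGraph.ConnectedComponent.sound (SimpleGraph.Adj.reachable ?_)⟩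
    exact hxy.symm
  · refine hB.antisymm fun w hw => ?_
    obtain ⟨b, hb⟩ := hne
    obtain ⟨hbS, rfl⟩ := mem_compSet.1 (hB hb)
    obtain ⟨hwS, hbw⟩ := mem_compSet.1 hw
    have hr := (SimpleGraph.ConnectedComponent.exact hbw).symm
    rw [SimpleGraph.reachable_iff_reflTransGen] at hr
    have : ∀ z : (Sᶜ : Set V), Relation.ReflTransGen (G.induce Sᶜ).Adj ⟨b, hbS⟩ z → z.1 ∈ B := by
      intro z hz
      induction hz with
      | refl => exact hb
      | @tail y z hy hyz ih =>
        refine hcl _ ih _ (mem_compSet.2 ⟨z.2, ?_⟩) hyz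
        rw [← SimpleGraph.reachable_iff_reflTransGen] at hy
        exact SimpleGraph.ConnectedComponent.sound (hy.trans hyz.reachable).symm
    exact this _ hr

theorem copy_compSet (c : (G.induce Sᶜ).ConnectedComponent) :
    Copy ((G.induce Sᶜ).induce c.supp) G (fun a => a.1.1) (compSet G S c) := by
  refine ⟨fun a b hab => Subtype.ext (Subtype.ext hab), fun a b => Iff.rfl, fun v => ?_⟩
  rw [mem_compSet]
  constructor
  · rintro ⟨hv, hc⟩
    exact ⟨⟨⟨v, hv⟩, hc⟩, rfl⟩
  · rintro ⟨a, rfl⟩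
    exact ⟨a.1.2, a.2⟩

theorem sunCount_eq_card_suns (hX : ∀ v, v ∈ X ↔ v ∉ S) :
    sunCount G S = (suns G X).card := by
  rw [sunCount, ← Nat.card_eq_finsetCard]
  refine Nat.card_congr (Equiv.ofBijective (fun c => ⟨compSet G S c.1, mem_suns.2
    ⟨comp_compSet hX c.1, (copy_compSet c.1).sun_of_isSun (comp_compSet hX c.1).ne c.2⟩⟩)
    ⟨fun c d hcd => ?_, fun C => ?_⟩)
  · obtain ⟨v, hv⟩ := (comp_compSet hX c.1).ne
    have heq : compSet G S c.1 = compSet G S d.1 := congrArg Subtype.val hcd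
    obtain ⟨_, hc⟩ := mem_compSet.1 hv
    obtain ⟨_, hd⟩ := mem_compSet.1 (heq ▸ hv)
    exact Subtype.ext (hc.symm.trans hd)
  · obtain ⟨C, hC⟩ := C
    obtain ⟨hC, hsun⟩ := mem_suns.1 hC
    obtain ⟨v, hv⟩ := hC.ne
    have hvS : v ∈ Sᶜ := (hX v).1 (hC.sub hv)
    have heq : compSet G S ((G.induce Sᶜ).connectedComponentMk ⟨v, hvS⟩) = C :=
      (comp_compSet hX _).eq_of_mem hC (mem_compSet.2 ⟨hvS, rfl⟩) hv
    exact ⟨⟨_, (copy_compSet _).isSun_of_sun (heq ▸ hsun)⟩, Subtype.ext heq⟩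

theorem kan_univ_iff : Kan G univ ↔ ∀ S : Set V, sunCount G S ≤ 2 * S.ncard := by
  classical
  constructor
  · intro h S
    rw [sunCount_eq_card_suns (X := univ \ S.toFinset) (by simp), Set.ncard_eq_toFinset_card']
    exact h _ (subset_univ _)
  · intro h S _
    rw [← sunCount_eq_card_suns (S := S) (by simp), ← Set.ncard_coe_finset]
    exact h S

end

end

end Kaneko


/-- Kaneko's theorem: a graph `G` has a `{P₃, P₄, P₅}`-factor if and only if
`sun(G − S) ≤ 2|S|` for every `S ⊆ V(G)`. -/
theorem ppp_factor_iff_sun {V : Type*} [Fintype V] (G : SimpleGraph V) :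
    HasPPPFactor G ↔ ∀ S : Set V, sunCount G S ≤ 2 * S.ncard := by
  classical
  rw [← Kaneko.kan_univ_iff, Kaneko.hasPPPFactor_iff_chart]
  constructor
  · rintro ⟨F, hF, hc⟩
    exact Kaneko.kan_of_chart hF hc
  · intro h
    obtain ⟨F, hF, -, hc⟩ := h.tiled.exists_chart
    exact ⟨F, hF, fun v => hc v (Finset.mem_univ v)⟩
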